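/- Let F = (X_n, K_n, π_n)_{n≥1} be a family of irreducible birth and death chains on X_n = {0,1,...,n} and let F_c be the family of associated continuous-time chains. Let λ_n be the smallest non-zero eigenvalue of I − K_n. For each n choose M_n ∈ X_n with inf_n π_n([0,M_n]) > 0 and inf_n π_n([M_n,n]) > 0, and set s_n = E_0 τ̃^{(n)}_{M_n} + E_n τ̃^{(n)}_{M_n} and b_n² = Var_0 τ̃^{(n)}_{M_n} + Var_n τ̃^{(n)}_{M_n}. Then F_c^L has a separation cutoff if and only if s_n λ_n → ∞, if and only if s_n/b_n → ∞; furthermore, if s_n/b_n → ∞, then F_c^L has a (s_n, b_n) separation cutoff. -/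

import Mathlib

open scoped BigOperators
open Filter Matrix Polynomial MeasureTheory

noncomputable section

/-- An irreducible birth and death chain on `{0,1,...,n}`, together with its
(unique) stationary distribution. -/
structure BDChain (n : ℕ) where
  K : Matrix (Fin (n + 1)) (Fin (n + 1)) ℝ
  pi : Fin (n + 1) → ℝ
  K_nonneg : ∀ i j, 0 ≤ K i j
  K_rowSum : ∀ i, ∑ j, K i j = 1
  K_tridiag : ∀ i j : Fin (n + 1), 1 < |(i : ℤ) - (j : ℤ)| → K i j = 0
  K_irred : ∀ i : ℕ, ∀ h : i < n,
    0 < K ⟨i, by omega⟩ ⟨i + 1, by omega⟩ ∧ 0 < K ⟨i + 1, by omega⟩ ⟨i, by omega⟩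
  pi_pos : ∀ i, 0 < pi i
  pi_sum : ∑ i, pi i = 1
  pi_stat : ∀ j, ∑ i, pi i * K i j = pi j

namespace BDChain

variable {n : ℕ}

/-- `π([0,M])` -/
def piLow (c : BDChain n) (M : Fin (n + 1)) : ℝ :=
  ∑ ℓ : Fin (n + 1), if ℓ ≤ M then c.pi ℓ else 0

/-- `π([M,n])` -/
def piHigh (c : BDChain n) (M : Fin (n + 1)) : ℝ :=
  ∑ ℓ : Fin (n + 1), if M ≤ ℓ then c.pi ℓ else 0

/-- `π([a,b])` -/
def piInt (c : BDChain n) (a b : Fin (n + 1)) : ℝ :=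
  ∑ ℓ : Fin (n + 1), if a ≤ ℓ ∧ ℓ ≤ b then c.pi ℓ else 0

/-- The substochastic matrix of the chain killed at state `i`. -/
def killed (c : BDChain n) (i : Fin (n + 1)) : Matrix (Fin (n + 1)) (Fin (n + 1)) ℝ :=
  Matrix.of fun x y => if x = i ∨ y = i then 0 else c.K x y

/-- `P_j(τ_i > m)`, where `τ_i` is the discrete-time hitting time of state `i`. -/
def hitSurv (c : BDChain n) (i j : Fin (n + 1)) (m : ℕ) : ℝ :=
  if j = i then 0 else ∑ y, (c.killed i ^ m) j y

/-- `P_j(τ̃_i > t)`, where `τ̃_i` is the continuous-time hitting time of state `i`. -/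
def hitSurvC (c : BDChain n) (i j : Fin (n + 1)) (t : ℝ) : ℝ :=
  ∑' m : ℕ, (Real.exp (-t) * t ^ m / m.factorial) * c.hitSurv i j m

/-- `E_j τ_i` -/
def hitMean (c : BDChain n) (i j : Fin (n + 1)) : ℝ :=
  ∑' m : ℕ, c.hitSurv i j m

/-- `Var_j τ_i` -/
def hitVar (c : BDChain n) (i j : Fin (n + 1)) : ℝ :=
  (∑' m : ℕ, (2 * (m : ℝ) + 1) * c.hitSurv i j m) - (c.hitMean i j) ^ 2

/-- `E_j τ̃_i` -/
def hitMeanC (c : BDChain n) (i j : Fin (n + 1)) : ℝ :=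
  ∫ t in Set.Ioi (0 : ℝ), c.hitSurvC i j t

/-- `Var_j τ̃_i` -/
def hitVarC (c : BDChain n) (i j : Fin (n + 1)) : ℝ :=
  (∫ t in Set.Ioi (0 : ℝ), 2 * t * c.hitSurvC i j t) - (c.hitMeanC i j) ^ 2

/-- The substochastic matrix of the chain killed at states `i` and `k`. -/
def killed2 (c : BDChain n) (i k : Fin (n + 1)) : Matrix (Fin (n + 1)) (Fin (n + 1)) ℝ :=
  Matrix.of fun x y => if x = i ∨ x = k ∨ y = i ∨ y = k then 0 else c.K x y

/-- `P_j(min{τ_i, τ_k} > m)` -/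
def hitSurv2 (c : BDChain n) (i k j : Fin (n + 1)) (m : ℕ) : ℝ :=
  if j = i ∨ j = k then 0 else ∑ y, (c.killed2 i k ^ m) j y

/-- `E_j min{τ_i, τ_k}` -/
def hitMean2 (c : BDChain n) (i k j : Fin (n + 1)) : ℝ :=
  ∑' m : ℕ, c.hitSurv2 i k j m

/-- `E_j min{τ̃_i, τ̃_k}` -/
def hitMean2C (c : BDChain n) (i k j : Fin (n + 1)) : ℝ :=
  ∫ t in Set.Ioi (0 : ℝ),
    ∑' m : ℕ, (Real.exp (-t) * t ^ m / m.factorial) * c.hitSurv2 i k j m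

/-- The continuous-time kernel `H_t(x,y) = e^{-t(I-K)}(x,y)`. -/
def Ht (c : BDChain n) (t : ℝ) (x y : Fin (n + 1)) : ℝ :=
  ∑' m : ℕ, (Real.exp (-t) * t ^ m / m.factorial) * (c.K ^ m) x y

/-- Discrete-time total variation distance from starting state `x` at time `m`. -/
def dTV (c : BDChain n) (x : Fin (n + 1)) (m : ℕ) : ℝ :=
  ⨆ A : Finset (Fin (n + 1)), (∑ y ∈ A, (c.K ^ m) x y - ∑ y ∈ A, c.pi y)

/-- Continuous-time total variation distance from starting state `x` at time `t`. -/
def dTVC (c : BDChain n) (x : Fin (n + 1)) (t : ℝ) : ℝ :=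
  ⨆ A : Finset (Fin (n + 1)), (∑ y ∈ A, c.Ht t x y - ∑ y ∈ A, c.pi y)

/-- Maximum (over starting states) discrete-time total variation distance. -/
def dTVMax (c : BDChain n) (m : ℕ) : ℝ := ⨆ x, c.dTV x m

/-- Maximum (over starting states) continuous-time total variation distance. -/
def dTVMaxC (c : BDChain n) (t : ℝ) : ℝ := ⨆ x, c.dTVC x t

/-- Discrete-time separation from starting state `x` at time `m`. -/
def sep (c : BDChain n) (x : Fin (n + 1)) (m : ℕ) : ℝ :=
  ⨆ y, (1 - (c.K ^ m) x y / c.pi y)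

/-- Continuous-time separation from starting state `x` at time `t`. -/
def sepC (c : BDChain n) (x : Fin (n + 1)) (t : ℝ) : ℝ :=
  ⨆ y, (1 - c.Ht t x y / c.pi y)

end BDChain

/-- Discrete-time `ε`-mixing time for a distance profile `d`. -/
def mixD (d : ℕ → ℝ) (ε : ℝ) : ℕ := sInf {m : ℕ | d m ≤ ε}

/-- Continuous-time `ε`-mixing time for a distance profile `d`. -/
def mixC (d : ℝ → ℝ) (ε : ℝ) : ℝ := sInf {t : ℝ | 0 ≤ t ∧ d t ≤ ε}

/-- The set of (real) eigenvalues of a square matrix. -/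
def eigSet {ι : Type*} [Fintype ι] (M : Matrix ι ι ℝ) : Set ℝ :=
  {x | ∃ v : ι → ℝ, v ≠ 0 ∧ M.mulVec v = x • v}

/-- `l` is the smallest non-zero eigenvalue of `M`. -/
def IsSmallestNonzeroEig {ι : Type*} [Fintype ι] (M : Matrix ι ι ℝ) (l : ℝ) : Prop :=
  l ∈ eigSet M ∧ l ≠ 0 ∧ ∀ x ∈ eigSet M, x ≠ 0 → l ≤ x

/-- `l` is the smallest eigenvalue of `M`. -/
def IsSmallestEig {ι : Type*} [Fintype ι] (M : Matrix ι ι ℝ) (l : ℝ) : Prop :=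
  l ∈ eigSet M ∧ ∀ x ∈ eigSet M, l ≤ x

/-- The principal submatrix of `I - K` indexed by the states `0, 1, ..., M-1`. -/
def BDChain.subIK {n : ℕ} (c : BDChain n) (M : Fin (n + 1)) :
    Matrix (Fin (M : ℕ)) (Fin (M : ℕ)) ℝ :=
  Matrix.of fun a b =>
    (1 - c.K) (Fin.castLE M.isLt.le a) (Fin.castLE M.isLt.le b)

/-- A family of chains, with `ε ↦ n ↦ T ε n` the mixing time profile, presents a cutoff
with cutoff time `t`. -/
def cutoffWith (T : ℝ → ℕ → ℝ) (t : ℕ → ℝ) : Prop :=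
  ∀ ε ∈ Set.Ioo (0 : ℝ) 1, Filter.Tendsto (fun n => T ε n / t n) Filter.atTop (nhds 1)

/-- A family of chains presents a cutoff. -/
def hasCutoff (T : ℝ → ℕ → ℝ) : Prop :=
  ∃ t : ℕ → ℝ, (∀ n, 0 < t n) ∧ cutoffWith T t

/-- A family of chains presents a `(t_n, b_n)` cutoff. -/
def cutoffWindow (T : ℝ → ℕ → ℝ) (t b : ℕ → ℝ) : Prop :=
  (∀ᶠ n in Filter.atTop, 0 < t n) ∧ (∀ᶠ n in Filter.atTop, 0 < b n) ∧
  Filter.Tendsto (fun n => b n / t n) Filter.atTop (nhds 0) ∧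
  ∀ ε ∈ Set.Ioo (0 : ℝ) 1, ∃ C : ℝ, ∀ᶠ n in Filter.atTop, |T ε n - t n| ≤ C * b n

namespace BDChain

variable {n : ℕ}

/-- The total flow of an antisymmetric nearest-neighbour flow out of an initial segment is carried
by the single edge leaving that segment. -/
lemma sum_cut (a : Fin (n + 1) → Fin (n + 1) → ℝ) (hanti : ∀ j y, a j y = -a y j)
    (hfar : ∀ j y : Fin (n + 1), (j : ℕ) + 1 < y → a j y = 0) (i : Fin n) :
    ∑ j, (if j ≤ i.castSucc then ∑ y, a j y else 0) = a i.castSucc i.succ := by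
  have hsplit : ∑ j, (if j ≤ i.castSucc then ∑ y, a j y else 0)
      = (∑ j, ∑ y, if j ≤ i.castSucc ∧ y ≤ i.castSucc then a j y else 0)
        + ∑ j, ∑ y, if j ≤ i.castSucc ∧ i.castSucc < y then a j y else 0 := by
    rw [← Finset.sum_add_distrib]
    refine Finset.sum_congr rfl fun j _ => ?_
    rw [← Finset.sum_add_distrib]
    by_cases hj : j ≤ i.castSucc
    · rw [if_pos hj]
      refine Finset.sum_congr rfl fun y _ => ?_
      by_cases hy : y ≤ i.castSucc
      · simp [hj, hy]
      · simp [hj, hy, not_le.mp hy]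
    · simp [hj]
  have hzero : (∑ j, ∑ y, if j ≤ i.castSucc ∧ y ≤ i.castSucc then a j y else 0) = 0 := by
    have h : (∑ j, ∑ y, if j ≤ i.castSucc ∧ y ≤ i.castSucc then a j y else 0)
        = -∑ j, ∑ y, if j ≤ i.castSucc ∧ y ≤ i.castSucc then a j y else 0 := by
      conv_lhs => rw [Finset.sum_comm]
      rw [← Finset.sum_neg_distrib]
      refine Finset.sum_congr rfl fun j _ => ?_
      rw [← Finset.sum_neg_distrib]
      refine Finset.sum_congr rfl fun y _ => ?_
      rw [hanti y j]
      by_cases hj : j ≤ i.castSucc <;> by_cases hy : y ≤ i.castSucc <;> simp [hj, hy]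
    linarith
  rw [hsplit, hzero, zero_add, Finset.sum_eq_single i.castSucc, Finset.sum_eq_single i.succ]
  · simp
  · intro y _ hy
    refine ite_eq_right_iff.mpr fun h => hfar _ _ ?_
    have h1 : (i : ℕ) < y := h.2
    have h2 : (y : ℕ) ≠ i + 1 := fun h => hy (Fin.ext h)
    simp only [Fin.val_castSucc]
    omega
  · simp
  · intro j _ hj
    refine Finset.sum_eq_zero fun y _ => ite_eq_right_iff.mpr fun h => hfar _ _ ?_
    have h1 : (i : ℕ) < y := h.2
    have h2 : (j : ℕ) ≤ i := h.1
    have h3 : (j : ℕ) ≠ i := fun h => hj (Fin.ext h)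
    omega
  · simp

/-- Functions on `Fin (n + 1)` are determined by their partial sums. -/
lemma eq_of_partial_sums {f g : Fin (n + 1) → ℝ}
    (h : ∀ i : Fin n, ∑ j, (if j ≤ i.castSucc then f j else 0)
      = ∑ j, (if j ≤ i.castSucc then g j else 0))
    (htot : ∑ j, f j = ∑ j, g j) : f = g := by
  have hall : ∀ k : Fin (n + 1), ∑ j, (if j ≤ k then f j else 0) = ∑ j, (if j ≤ k then g j else 0) := by
    intro k
    induction k using Fin.lastCases with
    | last => simpa [Fin.le_last] using htot
    | cast i => exact h i
  have hpred : ∀ k : Fin (n + 1), ∑ j, (if j < k then f j else 0) = ∑ j, (if j < k then g j else 0) := by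
    intro k
    induction k using Fin.cases with
    | zero => simp
    | succ i => simpa [Fin.le_castSucc_iff] using h i
  have hdiff : ∀ (u : Fin (n + 1) → ℝ) (k : Fin (n + 1)),
      u k = ∑ j, (if j ≤ k then u j else 0) - ∑ j, (if j < k then u j else 0) := by
    intro u k
    rw [← Finset.sum_sub_distrib, Finset.sum_eq_single k]
    · simp
    · intro j _ hj
      by_cases h : j ≤ k
      · simp [h, lt_of_le_of_ne h hj]
      · rw [if_neg h, if_neg fun h' => h h'.le, sub_zero]
    · simp
  funext k
  rw [hdiff f, hdiff g, hall, hpred]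

lemma sum_castSucc_sub_succ (f : Fin (n + 1) → ℝ) :
    ∑ i : Fin n, (f i.castSucc - f i.succ) = f 0 - f (Fin.last n) := by
  rw [Finset.sum_sub_distrib]
  have h1 := Fin.sum_univ_succ f
  have h2 := Fin.sum_univ_castSucc f
  linarith

variable (c : BDChain n)

lemma K_eq_zero_of_lt {x y : Fin (n + 1)} (h : (x : ℕ) + 1 < y) : c.K x y = 0 := by
  refine c.K_tridiag x y ?_
  rw [abs_sub_comm]
  refine lt_of_lt_of_le ?_ (le_abs_self _)
  omega

lemma K_eq_zero_of_gt {x y : Fin (n + 1)} (h : (y : ℕ) + 1 < x) : c.K x y = 0 := by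
  refine c.K_tridiag x y (lt_of_lt_of_le ?_ (le_abs_self _))
  omega

lemma detailed_balance_succ (i : Fin n) :
    c.pi i.castSucc * c.K i.castSucc i.succ = c.pi i.succ * c.K i.succ i.castSucc := by
  have h := sum_cut (fun j y => c.pi j * c.K j y - c.pi y * c.K y j) (fun j y => by ring)
    (fun j y h => by rw [c.K_eq_zero_of_lt h, c.K_eq_zero_of_gt h]; ring) i
  have h0 : ∀ j, ∑ y, (c.pi j * c.K j y - c.pi y * c.K y j) = 0 := by
    intro j
    rw [Finset.sum_sub_distrib, ← Finset.mul_sum, c.K_rowSum, c.pi_stat]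
    ring
  simp only [h0, ite_self, Finset.sum_const_zero] at h
  linarith

lemma detailed_balance (x y : Fin (n + 1)) : c.pi x * c.K x y = c.pi y * c.K y x := by
  wlog hxy : x ≤ y generalizing x y
  · exact (this y x (not_le.mp hxy).le).symm
  have hle : (x : ℕ) ≤ y := hxy
  rcases Nat.lt_or_ge ((x : ℕ) + 1) y with h | h
  · rw [c.K_eq_zero_of_lt h, c.K_eq_zero_of_gt h]; ring
  rcases Nat.eq_or_lt_of_le hle with h' | h'
  · rw [Fin.ext h']
  · have hn : (x : ℕ) < n := by have := y.isLt; omega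
    have := c.detailed_balance_succ ⟨x, hn⟩
    have e1 : (⟨x, hn⟩ : Fin n).castSucc = x := Fin.ext rfl
    have e2 : (⟨x, hn⟩ : Fin n).succ = y := Fin.ext (by simp; omega)
    rwa [e1, e2] at this

/-- The generator `I - K` acting on functions. -/
def lap (f : Fin (n + 1) → ℝ) : Fin (n + 1) → ℝ := (1 - c.K).mulVec f

lemma lap_apply (f : Fin (n + 1) → ℝ) (x : Fin (n + 1)) :
    c.lap f x = ∑ y, c.K x y * (f x - f y) := by
  rw [lap, Matrix.sub_mulVec, Matrix.one_mulVec, Pi.sub_apply]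
  simp only [Matrix.mulVec, dotProduct, mul_sub, Finset.sum_sub_distrib, ← Finset.sum_mul,
    c.K_rowSum, one_mul]

/-- The conductance of the edge `{i, i+1}`. -/
def cond (i : Fin n) : ℝ := c.pi i.castSucc * c.K i.castSucc i.succ

lemma cond_pos (i : Fin n) : 0 < c.cond i :=
  mul_pos (c.pi_pos _) (c.K_irred i i.isLt).1

lemma sum_lap_le (f : Fin (n + 1) → ℝ) (i : Fin n) :
    ∑ j, (if j ≤ i.castSucc then c.pi j * c.lap f j else 0)
      = c.cond i * (f i.castSucc - f i.succ) := by
  have h := sum_cut (fun j y => c.pi j * c.K j y * (f j - f y))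
    (fun j y => by rw [c.detailed_balance j y]; ring)
    (fun j y h => by rw [c.K_eq_zero_of_lt h]; ring) i
  rw [cond, ← h]
  simp only [lap_apply, Finset.mul_sum, mul_assoc]

/-- The generator is self-adjoint in `ℓ²(π)`. -/
lemma sum_pi_mul_lap (f g : Fin (n + 1) → ℝ) :
    ∑ x, c.pi x * (f x * c.lap g x) = ∑ x, c.pi x * (g x * c.lap f x) := by
  have h : ∀ f g : Fin (n + 1) → ℝ, ∑ x, c.pi x * (f x * c.lap g x)
      = ∑ x, c.pi x * (f x * g x) - ∑ x, ∑ y, c.pi x * c.K x y * (f x * g y) := by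
    intro f g
    rw [← Finset.sum_sub_distrib]
    refine Finset.sum_congr rfl fun x _ => ?_
    rw [lap_apply]
    simp only [mul_sub, Finset.sum_sub_distrib, ← Finset.sum_mul, c.K_rowSum]
    rw [one_mul, Finset.mul_sum, Finset.mul_sum]
    congr 1
    refine Finset.sum_congr rfl fun y _ => by ring
  rw [h f g, h g f]
  congr 1
  · exact Finset.sum_congr rfl fun x _ => by ring
  · rw [Finset.sum_comm]
    refine Finset.sum_congr rfl fun x _ => Finset.sum_congr rfl fun y _ => ?_
    rw [c.detailed_balance]; ring

lemma lap_const (a : ℝ) : c.lap (fun _ => a) = 0 := by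
  funext x; simp [lap_apply]

lemma lap_sub (f g : Fin (n + 1) → ℝ) : c.lap (fun x => f x - g x) = c.lap f - c.lap g :=
  Matrix.mulVec_sub _ f g

lemma lap_smul (a : ℝ) (f : Fin (n + 1) → ℝ) : c.lap (fun x => a * f x) = a • c.lap f :=
  Matrix.mulVec_smul _ a f

lemma sum_pi_lap (f : Fin (n + 1) → ℝ) : ∑ x, c.pi x * c.lap f x = 0 := by
  have h := c.sum_pi_mul_lap (fun _ => 1) f
  simpa [c.lap_const] using h

lemma sum_pi_mul_lap_self_nonneg (f : Fin (n + 1) → ℝ) :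
    0 ≤ ∑ x, c.pi x * (f x * c.lap f x) := by
  have h : 2 * ∑ x, c.pi x * (f x * c.lap f x)
      = ∑ x, ∑ y, c.pi x * c.K x y * (f x - f y) ^ 2 := by
    have e1 : ∑ x, c.pi x * (f x * c.lap f x)
        = ∑ x, ∑ y, c.pi x * c.K x y * (f x * (f x - f y)) := by
      refine Finset.sum_congr rfl fun x _ => ?_
      rw [lap_apply, Finset.mul_sum, Finset.mul_sum]
      exact Finset.sum_congr rfl fun y _ => by ring
    have e2 : ∑ x, c.pi x * (f x * c.lap f x)
        = ∑ x, ∑ y, c.pi x * c.K x y * (f y * (f y - f x)) := by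
      rw [e1, Finset.sum_comm]
      refine Finset.sum_congr rfl fun x _ => Finset.sum_congr rfl fun y _ => ?_
      rw [c.detailed_balance]
    rw [two_mul]
    nth_rewrite 1 [e1]
    rw [e2, ← Finset.sum_add_distrib]
    refine Finset.sum_congr rfl fun x _ => ?_
    rw [← Finset.sum_add_distrib]
    exact Finset.sum_congr rfl fun y _ => by ring
  have : 0 ≤ ∑ x, ∑ y, c.pi x * c.K x y * (f x - f y) ^ 2 :=
    Finset.sum_nonneg fun x _ => Finset.sum_nonneg fun y _ =>
      mul_nonneg (mul_nonneg (c.pi_pos x).le (c.K_nonneg x y)) (sq_nonneg _)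
  linarith

/-- Harmonic functions are constant. -/
lemma eq_of_lap_eq_zero {f : Fin (n + 1) → ℝ} (h : c.lap f = 0) (x : Fin (n + 1)) : f x = f 0 := by
  induction x using Fin.induction with
  | zero => rfl
  | succ i ih =>
    have h1 := c.sum_lap_le f i
    simp only [h, Pi.zero_apply, mul_zero, ite_self, Finset.sum_const_zero] at h1
    have h2 := (mul_eq_zero.mp h1.symm).resolve_left (c.cond_pos i).ne'
    linarith

/-- A solution of the Poisson equation with monotone centred right-hand side is monotone. -/
lemma antitone_of_lap {f w : Fin (n + 1) → ℝ} (hw : c.lap w = f) (hf : Antitone f)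
    (hmean : ∑ x, c.pi x * f x = 0) : Antitone w := by
  rw [Fin.antitone_iff_succ_le]
  intro i
  have h1 := c.sum_lap_le w i
  rw [hw] at h1
  have h2 : 0 ≤ ∑ j, (if j ≤ i.castSucc then c.pi j * f j else 0) := by
    by_cases hi : 0 ≤ f i.castSucc
    · refine Finset.sum_nonneg fun j _ => ?_
      split_ifs with hj
      · exact mul_nonneg (c.pi_pos j).le (hi.trans (hf hj))
      · exact le_rfl
    · refine hmean.ge.trans ?_
      refine Finset.sum_le_sum fun j _ => ?_
      split_ifs with hj
      · exact le_rfl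
      · exact mul_nonpos_of_nonneg_of_nonpos (c.pi_pos j).le
          ((hf (not_le.mp hj).le).trans (not_le.mp hi).le)
  rw [h1] at h2
  have := nonneg_of_mul_nonneg_right h2 (c.cond_pos i)
  linarith

/-- The resistance between `0` and `x`. -/
def res (x : Fin (n + 1)) : ℝ := ∑ i : Fin n, if i.castSucc < x then (c.cond i)⁻¹ else 0

lemma res_mono : Monotone c.res := by
  intro x y h
  refine Finset.sum_le_sum fun i _ => ?_
  have := (inv_pos.mpr (c.cond_pos i)).le
  by_cases hx : i.castSucc < x
  · simp [hx, hx.trans_le h]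
  · rw [if_neg hx]; split_ifs
    · exact this
    · exact le_rfl

lemma res_succ (i : Fin n) : c.res i.succ = c.res i.castSucc + (c.cond i)⁻¹ := by
  have : ∀ j : Fin n, (if j.castSucc < i.succ then (c.cond j)⁻¹ else 0)
      = (if j.castSucc < i.castSucc then (c.cond j)⁻¹ else 0) + if j = i then (c.cond j)⁻¹ else 0 := by
    intro j
    rcases lt_trichotomy j i with h | h | h
    · simp [h, h.ne, h.le, Fin.castSucc_lt_succ_iff]
    · simp [h, Fin.castSucc_lt_succ_iff]
    · simp [h.ne', h.not_ge, h.not_gt, Fin.castSucc_lt_succ_iff]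
  simp only [res, this, Finset.sum_add_distrib, Finset.sum_ite_eq', Finset.mem_univ, if_true]

/-- The symmetrised Green kernel of the chain killed at `M`. -/
def green (M x y : Fin (n + 1)) : ℝ :=
  (|c.res x - c.res M| + |c.res y - c.res M| - |c.res x - c.res y|) / 2

lemma green_comm (M x y : Fin (n + 1)) : c.green M x y = c.green M y x := by
  rw [green, green, abs_sub_comm (c.res x) (c.res y)]; ring

lemma green_nonneg (M x y : Fin (n + 1)) : 0 ≤ c.green M x y := by
  have := abs_sub_le (c.res x) (c.res M) (c.res y)
  rw [abs_sub_comm (c.res M)] at this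
  rw [green]; linarith

lemma green_self_left (M y : Fin (n + 1)) : c.green M M y = 0 := by
  rw [green, abs_sub_comm (c.res y)]; simp

lemma green_eq_zero (M x y : Fin (n + 1)) (h : x ≤ M ∧ M ≤ y ∨ y ≤ M ∧ M ≤ x) :
    c.green M x y = 0 := by
  wlog h' : x ≤ M ∧ M ≤ y generalizing x y
  · rw [green_comm]
    exact this y x h.symm (h.resolve_left h')
  have h1 := c.res_mono h'.1
  have h2 := c.res_mono h'.2
  rw [green, abs_of_nonpos (by linarith), abs_of_nonneg (by linarith), abs_of_nonpos (by linarith)]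
  ring

lemma cond_mul_green_sub (M y : Fin (n + 1)) (i : Fin n) :
    c.cond i * (c.green M i.castSucc y - c.green M i.succ y)
      = (if y ≤ i.castSucc then 1 else 0) - if M ≤ i.castSucc then 1 else 0 := by
  have hdist : ∀ z : Fin (n + 1), c.cond i * (|c.res i.castSucc - c.res z| - |c.res i.succ - c.res z|)
      = 1 - 2 * if z ≤ i.castSucc then 1 else 0 := by
    intro z
    have hr := c.res_succ i
    have hc := c.cond_pos i
    have hinv := inv_pos.mpr hc
    by_cases hz : z ≤ i.castSucc
    · have h1 := c.res_mono hz
      rw [abs_of_nonneg (by linarith), abs_of_nonneg (by linarith), if_pos hz, hr]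
      field_simp
      ring
    · have h1 : c.res i.succ ≤ c.res z := c.res_mono (Fin.castSucc_lt_iff_succ_le.mp (not_le.mp hz))
      rw [abs_of_nonpos (by linarith), abs_of_nonpos (by linarith), if_neg hz, hr]
      field_simp
      ring
  have h1 := hdist M
  have h2 := hdist y
  have : c.green M i.castSucc y - c.green M i.succ y
      = ((|c.res i.castSucc - c.res M| - |c.res i.succ - c.res M|)
        - (|c.res i.castSucc - c.res y| - |c.res i.succ - c.res y|)) / 2 := by
    simp only [green]; ring
  rw [this, mul_div_assoc', mul_sub, h1, h2]
  ring

lemma pi_mul_lap_green (M y x : Fin (n + 1)) :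
    c.pi x * c.lap (fun x => c.green M x y) x
      = (if x = y then 1 else 0) - if x = M then 1 else 0 := by
  have key : (fun x => c.pi x * c.lap (fun x => c.green M x y) x)
      = fun x => (if x = y then 1 else 0) - if x = M then 1 else 0 := by
    refine eq_of_partial_sums (fun i => ?_) ?_
    · rw [sum_lap_le, cond_mul_green_sub]
      have h : ∀ z : Fin (n + 1), ∑ j, (if j ≤ i.castSucc then (if j = z then (1 : ℝ) else 0) else 0)
          = if z ≤ i.castSucc then 1 else 0 := by
        intro z
        rw [Finset.sum_eq_single z]
        · simp
        · intro j _ hj; simp [hj]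
        · simp
      rw [← h y, ← h M, ← Finset.sum_sub_distrib]
      refine Finset.sum_congr rfl fun j _ => ?_
      split_ifs <;> simp
    · rw [sum_pi_lap]; simp
  exact congrFun key x

lemma lap_sum (a : Fin (n + 1) → ℝ) (g : Fin (n + 1) → Fin (n + 1) → ℝ) (x : Fin (n + 1)) :
    c.lap (fun x => ∑ z, g x z * a z) x = ∑ z, a z * c.lap (fun x => g x z) x := by
  simp only [lap_apply, Finset.mul_sum, ← Finset.sum_sub_distrib]
  rw [Finset.sum_comm]
  exact Finset.sum_congr rfl fun z _ => Finset.sum_congr rfl fun y _ => by ring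

/-- The Green operator of the chain killed at `M`. -/
def potOf (M : Fin (n + 1)) (f : Fin (n + 1) → ℝ) (x : Fin (n + 1)) : ℝ :=
  ∑ z, c.green M x z * (c.pi z * f z)

lemma pi_mul_lap_potOf (M : Fin (n + 1)) (f : Fin (n + 1) → ℝ) (x : Fin (n + 1)) :
    c.pi x * c.lap (c.potOf M f) x
      = c.pi x * f x - if x = M then ∑ z, c.pi z * f z else 0 := by
  have : c.potOf M f = fun x => ∑ z, c.green M x z * (c.pi z * f z) := rfl
  rw [this, lap_sum, Finset.mul_sum]
  have h : ∀ z, c.pi x * (c.pi z * f z * c.lap (fun x => c.green M x z) x)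
      = (if x = z then c.pi z * f z else 0) - if x = M then c.pi z * f z else 0 := by
    intro z
    have := c.pi_mul_lap_green M z x
    calc _ = c.pi z * f z * (c.pi x * c.lap (fun x => c.green M x z) x) := by ring
      _ = _ := by rw [this]; split_ifs <;> ring
  simp only [h, Finset.sum_sub_distrib]
  congr 1
  · simp
  · split_ifs <;> simp

lemma potOf_nonneg (M : Fin (n + 1)) {f : Fin (n + 1) → ℝ} (hf : ∀ x, 0 ≤ f x) (x : Fin (n + 1)) :
    0 ≤ c.potOf M f x :=
  Finset.sum_nonneg fun z _ => mul_nonneg (c.green_nonneg M x z) (mul_nonneg (c.pi_pos z).le (hf z))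

lemma potOf_self (M : Fin (n + 1)) (f : Fin (n + 1) → ℝ) : c.potOf M f M = 0 :=
  Finset.sum_eq_zero fun z _ => by rw [green_self_left, zero_mul]

lemma lap_potOf (M : Fin (n + 1)) (f : Fin (n + 1) → ℝ) {x : Fin (n + 1)} (hx : x ≠ M) :
    c.lap (c.potOf M f) x = f x := by
  have h := c.pi_mul_lap_potOf M f x
  rw [if_neg hx, sub_zero] at h
  exact mul_left_cancel₀ (c.pi_pos x).ne' h

lemma sum_pi_potOf_mul (M : Fin (n + 1)) (f g : Fin (n + 1) → ℝ) :
    ∑ x, c.pi x * (c.potOf M f x * g x) = ∑ x, c.pi x * (f x * c.potOf M g x) := by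
  simp only [potOf, Finset.mul_sum, Finset.sum_mul]
  rw [Finset.sum_comm]
  refine Finset.sum_congr rfl fun x _ => Finset.sum_congr rfl fun y _ => ?_
  rw [green_comm]; ring

/-- The expected hitting time of `M`, as a function of the starting point. -/
def pot (M : Fin (n + 1)) : Fin (n + 1) → ℝ := c.potOf M fun _ => 1

lemma pot_eq (M x : Fin (n + 1)) : c.pot M x = ∑ z, c.green M x z * c.pi z := by
  simp [pot, potOf]

def potMean (M : Fin (n + 1)) : ℝ := ∑ x, c.pi x * c.pot M x

def potSq (M : Fin (n + 1)) : ℝ := ∑ x, c.pi x * c.pot M x ^ 2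

def greenTr (M : Fin (n + 1)) : ℝ := ∑ x, c.pi x * c.green M x x

def greenTrSq (M : Fin (n + 1)) : ℝ := ∑ x, ∑ z, c.pi x * (c.pi z * c.green M x z ^ 2)

lemma green_zero_add_green_last (M y : Fin (n + 1)) :
    c.green M 0 y + c.green M (Fin.last n) y = c.green M y y := by
  have h0 := c.res_mono (Fin.zero_le M)
  have h1 := c.res_mono (Fin.zero_le y)
  have h2 := c.res_mono (Fin.le_last M)
  have h3 := c.res_mono (Fin.le_last y)
  rw [green, green, green, abs_of_nonpos (sub_nonpos.mpr h0), abs_of_nonpos (sub_nonpos.mpr h1),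
    abs_of_nonneg (sub_nonneg.mpr h2), abs_of_nonneg (sub_nonneg.mpr h3), sub_self, abs_zero]
  ring

lemma green_sq_eq (M y z : Fin (n + 1)) :
    (c.green M 0 y + c.green M 0 z) * c.green M y z - c.green M 0 y * c.green M 0 z
      + ((c.green M (Fin.last n) y + c.green M (Fin.last n) z) * c.green M y z
        - c.green M (Fin.last n) y * c.green M (Fin.last n) z) = c.green M y z ^ 2 := by
  have h0 := c.res_mono (Fin.zero_le M)
  have h1 := c.res_mono (Fin.zero_le y)
  have h2 := c.res_mono (Fin.le_last M)
  have h3 := c.res_mono (Fin.le_last y)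
  have h4 := c.res_mono (Fin.zero_le z)
  have h5 := c.res_mono (Fin.le_last z)
  simp only [green]
  rw [abs_of_nonpos (sub_nonpos.mpr h0), abs_of_nonpos (sub_nonpos.mpr h1),
    abs_of_nonneg (sub_nonneg.mpr h2), abs_of_nonneg (sub_nonneg.mpr h3),
    abs_of_nonpos (sub_nonpos.mpr h4), abs_of_nonneg (sub_nonneg.mpr h5)]
  rcases abs_cases (c.res y - c.res M) with ⟨e1, _⟩ | ⟨e1, _⟩ <;>
  rcases abs_cases (c.res z - c.res M) with ⟨e2, _⟩ | ⟨e2, _⟩ <;>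
  rcases abs_cases (c.res y - c.res z) with ⟨e3, _⟩ | ⟨e3, _⟩ <;>
  rw [e1, e2, e3] <;> ring

lemma pot_zero_add_pot_last (M : Fin (n + 1)) :
    c.pot M 0 + c.pot M (Fin.last n) = c.greenTr M := by
  rw [pot_eq, pot_eq, ← Finset.sum_add_distrib]
  refine Finset.sum_congr rfl fun y _ => ?_
  rw [← green_zero_add_green_last]; ring

lemma two_mul_potOf_pot (M x : Fin (n + 1)) :
    2 * c.potOf M (c.pot M) x - c.pot M x ^ 2
      = ∑ y, ∑ z, c.pi y * (c.pi z * ((c.green M x y + c.green M x z) * c.green M y z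
        - c.green M x y * c.green M x z)) := by
  have h1 : c.potOf M (c.pot M) x
      = ∑ y, ∑ z, c.pi y * (c.pi z * (c.green M x y * c.green M y z)) := by
    simp only [potOf, pot_eq, Finset.mul_sum]
    exact Finset.sum_congr rfl fun y _ => Finset.sum_congr rfl fun z _ => by ring
  have h2 : c.potOf M (c.pot M) x
      = ∑ y, ∑ z, c.pi y * (c.pi z * (c.green M x z * c.green M y z)) := by
    rw [h1, Finset.sum_comm]
    refine Finset.sum_congr rfl fun y _ => Finset.sum_congr rfl fun z _ => ?_
    rw [c.green_comm M y z]; ring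
  have h3 : c.pot M x ^ 2 = ∑ y, ∑ z, c.pi y * (c.pi z * (c.green M x y * c.green M x z)) := by
    rw [sq, pot_eq, Finset.sum_mul_sum]
    exact Finset.sum_congr rfl fun y _ => Finset.sum_congr rfl fun z _ => by ring
  rw [two_mul]
  nth_rewrite 1 [h1]
  rw [h2, h3, ← Finset.sum_add_distrib, ← Finset.sum_sub_distrib]
  refine Finset.sum_congr rfl fun y _ => ?_
  rw [← Finset.sum_add_distrib, ← Finset.sum_sub_distrib]
  exact Finset.sum_congr rfl fun z _ => by ring

lemma variance_sum_eq_greenTrSq (M : Fin (n + 1)) :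
    (2 * c.potOf M (c.pot M) 0 - c.pot M 0 ^ 2)
      + (2 * c.potOf M (c.pot M) (Fin.last n) - c.pot M (Fin.last n) ^ 2) = c.greenTrSq M := by
  rw [two_mul_potOf_pot, two_mul_potOf_pot, greenTrSq, ← Finset.sum_add_distrib]
  refine Finset.sum_congr rfl fun y _ => ?_
  rw [← Finset.sum_add_distrib]
  refine Finset.sum_congr rfl fun z _ => ?_
  rw [← green_sq_eq]; ring

/-- The symmetrised kernel of the deviation matrix `∫₀^∞ (H_t - π) dt`. -/
def dev (x z : Fin (n + 1)) : ℝ :=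
  c.green (Fin.last n) x z - c.pot (Fin.last n) x - c.pot (Fin.last n) z + c.potMean (Fin.last n)

/-- The deviation kernel is the centred Green kernel of the chain killed at any state. -/
lemma dev_eq (M x z : Fin (n + 1)) :
    c.dev x z = c.green M x z - c.pot M x - c.pot M z + c.potMean M := by
  have key : ∀ M x z : Fin (n + 1), c.green M x z - c.pot M x - c.pot M z + c.potMean M
      = (-|c.res x - c.res z| + ∑ y, |c.res x - c.res y| * c.pi y
        + ∑ y, |c.res z - c.res y| * c.pi y
        - ∑ w, c.pi w * ∑ y, |c.res w - c.res y| * c.pi y) / 2 := by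
    intro M x z
    have hpot : ∀ x, c.pot M x = (|c.res x - c.res M| + ∑ y, |c.res y - c.res M| * c.pi y
        - ∑ y, |c.res x - c.res y| * c.pi y) / 2 := by
      intro x
      have : |c.res x - c.res M| = ∑ y, |c.res x - c.res M| * c.pi y := by
        rw [← Finset.mul_sum, c.pi_sum, mul_one]
      rw [this, pot_eq, ← Finset.sum_add_distrib, ← Finset.sum_sub_distrib, Finset.sum_div]
      exact Finset.sum_congr rfl fun y _ => by rw [green]; ring
    have hmean : c.potMean M = (2 * ∑ y, |c.res y - c.res M| * c.pi y
        - ∑ w, c.pi w * ∑ y, |c.res w - c.res y| * c.pi y) / 2 := by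
      have h1 : ∑ w, c.pi w * (∑ y, |c.res y - c.res M| * c.pi y)
          = ∑ y, |c.res y - c.res M| * c.pi y := by
        rw [← Finset.sum_mul, c.pi_sum, one_mul]
      rw [two_mul]
      nth_rewrite 2 [← h1]
      rw [← Finset.sum_add_distrib, ← Finset.sum_sub_distrib, Finset.sum_div, potMean]
      exact Finset.sum_congr rfl fun w _ => by rw [hpot]; ring
    rw [hpot, hpot, hmean, green]; ring
  rw [dev, key, key]

lemma dev_comm (x z : Fin (n + 1)) : c.dev x z = c.dev z x := by
  rw [dev, dev, green_comm]; ring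

lemma sum_pi_dev (x : Fin (n + 1)) : ∑ z, c.pi z * c.dev x z = 0 := by
  have h : ∀ z, c.pi z * c.dev x z = c.green (Fin.last n) x z * c.pi z
      - c.pi z * c.pot (Fin.last n) x - c.pi z * c.pot (Fin.last n) z
      + c.pi z * c.potMean (Fin.last n) := fun z => by rw [dev]; ring
  simp only [h, Finset.sum_add_distrib, Finset.sum_sub_distrib, ← Finset.sum_mul, c.pi_sum, ← pot_eq]
  rw [← potMean]; ring

lemma pi_mul_lap_dev (z x : Fin (n + 1)) :
    c.pi x * c.lap (fun x => c.dev x z) x = (if x = z then 1 else 0) - c.pi x := by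
  have h : (fun x => c.dev x z) = fun x => (c.green (Fin.last n) x z - c.pot (Fin.last n) x)
      - (c.pot (Fin.last n) z - c.potMean (Fin.last n)) := by
    funext x; rw [dev]; ring
  rw [h, lap_sub c (fun x => c.green (Fin.last n) x z - c.pot (Fin.last n) x) (fun _ => _),
    lap_const, sub_zero, lap_sub c (fun x => c.green (Fin.last n) x z), Pi.sub_apply, mul_sub,
    pi_mul_lap_green, pot, pi_mul_lap_potOf]
  simp [c.pi_sum]

def devTr : ℝ := ∑ x, c.pi x * c.dev x x

def devTrSq : ℝ := ∑ x, ∑ z, c.pi x * (c.pi z * c.dev x z ^ 2)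

lemma devTr_eq (M : Fin (n + 1)) : c.devTr = c.greenTr M - c.potMean M := by
  have h : ∀ x, c.pi x * c.dev x x = c.pi x * c.green M x x - 2 * (c.pi x * c.pot M x)
      + c.pi x * c.potMean M := fun x => by rw [c.dev_eq M]; ring
  simp only [devTr, h, Finset.sum_add_distrib, Finset.sum_sub_distrib, ← Finset.sum_mul, c.pi_sum,
    ← Finset.mul_sum]
  rw [← potMean, ← greenTr]; ring

lemma devTrSq_eq (M : Fin (n + 1)) :
    c.devTrSq = c.greenTrSq M - 2 * c.potSq M + c.potMean M ^ 2 := by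
  have hinner : ∀ x, ∑ z, c.pi x * (c.pi z * c.dev x z ^ 2)
      = (∑ z, c.pi x * (c.pi z * c.green M x z ^ 2)) - c.pi x * c.pot M x ^ 2
        + c.pi x * (c.potSq M - c.potMean M ^ 2) - 2 * (c.pi x * (1 * c.potOf M (c.pot M) x))
        + 2 * c.potMean M * (c.pi x * c.pot M x) := by
    intro x
    have h : ∀ z, c.pi x * (c.pi z * c.dev x z ^ 2)
        = c.pi x * (c.pi z * c.green M x z ^ 2)
          + c.pi x * (c.pot M x ^ 2 + c.potMean M ^ 2 - 2 * c.pot M x * c.potMean M) * c.pi z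
          + c.pi x * (c.pi z * c.pot M z ^ 2)
          + c.pi x * (2 * c.potMean M - 2 * c.pot M x) * (c.green M x z * c.pi z)
          - 2 * c.pi x * (c.green M x z * (c.pi z * c.pot M z))
          + c.pi x * (2 * c.pot M x - 2 * c.potMean M) * (c.pi z * c.pot M z) :=
      fun z => by rw [c.dev_eq M]; ring
    simp only [h, Finset.sum_add_distrib, Finset.sum_sub_distrib]
    rw [← Finset.mul_sum (f := fun z => c.pi z), ← Finset.mul_sum (f := fun z => c.pi z * c.pot M z ^ 2),
      ← Finset.mul_sum (f := fun z => c.green M x z * c.pi z),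
      ← Finset.mul_sum (f := fun z => c.green M x z * (c.pi z * c.pot M z)),
      ← Finset.mul_sum (f := fun z => c.pi z * c.pot M z), ← pot_eq, c.pi_sum, ← potMean, ← potSq,
      ← potOf]
    ring
  rw [devTrSq, greenTrSq]
  simp only [hinner, Finset.sum_add_distrib, Finset.sum_sub_distrib]
  rw [← Finset.mul_sum (f := fun x => c.pi x * (1 * c.potOf M (c.pot M) x)),
    ← sum_pi_potOf_mul, ← Finset.mul_sum (f := fun x => c.pi x * c.pot M x), ← Finset.sum_mul,
    c.pi_sum, ← potMean, ← potSq]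
  have : ∑ x, c.pi x * (c.potOf M (fun _ => 1) x * c.pot M x) = c.potSq M := by
    rw [potSq]; exact Finset.sum_congr rfl fun x _ => by rw [sq, pot]
  rw [this]; ring

/-- The density gap `1 - δ_n / π(n)` at the right end point. -/
def gap (x : Fin (n + 1)) : ℝ := 1 - if x = Fin.last n then (c.pi (Fin.last n))⁻¹ else 0

def gap₁ (x : Fin (n + 1)) : ℝ := -c.dev x (Fin.last n)

def gap₂ (x : Fin (n + 1)) : ℝ := ∑ y, c.dev x y * (c.pi y * c.gap₁ y)

lemma gap_antitone : Antitone c.gap := by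
  intro x y h
  have := (inv_pos.mpr (c.pi_pos (Fin.last n))).le
  by_cases hx : x = Fin.last n
  · have hy : y = Fin.last n := le_antisymm (Fin.le_last y) (hx ▸ h)
    rw [hx, hy]
  · simp only [gap, if_neg hx]
    split_ifs <;> linarith

lemma sum_pi_gap : ∑ x, c.pi x * c.gap x = 0 := by
  simp [gap, mul_sub, Finset.sum_sub_distrib, c.pi_sum, (c.pi_pos (Fin.last n)).ne']

lemma lap_gap₁ : c.lap c.gap₁ = c.gap := by
  funext x
  refine mul_left_cancel₀ (c.pi_pos x).ne' ?_
  have h : c.gap₁ = fun x => (-1) * c.dev x (Fin.last n) := by funext x; rw [gap₁]; ring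
  rw [h, lap_smul, Pi.smul_apply, smul_eq_mul, mul_left_comm, pi_mul_lap_dev, gap]
  split_ifs with hx
  · rw [hx]; have := (c.pi_pos (Fin.last n)).ne'; field_simp; ring
  · ring

lemma sum_pi_gap₁ : ∑ x, c.pi x * c.gap₁ x = 0 := by
  have := c.sum_pi_dev (Fin.last n)
  simp only [gap₁, mul_neg, Finset.sum_neg_distrib, c.dev_comm _ (Fin.last n), this, neg_zero]

lemma gap₁_antitone : Antitone c.gap₁ := c.antitone_of_lap c.lap_gap₁ c.gap_antitone c.sum_pi_gap

lemma lap_gap₂ : c.lap c.gap₂ = c.gap₁ := by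
  funext x
  refine mul_left_cancel₀ (c.pi_pos x).ne' ?_
  have h : c.gap₂ = fun x => ∑ y, c.dev x y * (c.pi y * c.gap₁ y) := rfl
  rw [h, lap_sum, Finset.mul_sum]
  have h : ∀ z, c.pi x * (c.pi z * c.gap₁ z * c.lap (fun x => c.dev x z) x)
      = (if x = z then c.pi z * c.gap₁ z else 0) - c.pi x * (c.pi z * c.gap₁ z) := by
    intro z
    calc _ = c.pi z * c.gap₁ z * (c.pi x * c.lap (fun x => c.dev x z) x) := by ring
      _ = _ := by rw [pi_mul_lap_dev]; split_ifs <;> ring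
  simp only [h, Finset.sum_sub_distrib, ← Finset.mul_sum, sum_pi_gap₁]
  simp

lemma sum_pi_gap₂ : ∑ x, c.pi x * c.gap₂ x = 0 := by
  simp only [gap₂, Finset.mul_sum]
  rw [Finset.sum_comm]
  refine Finset.sum_eq_zero fun y _ => ?_
  calc _ = (c.pi y * c.gap₁ y) * ∑ x, c.pi x * c.dev y x := by
        rw [Finset.mul_sum]
        exact Finset.sum_congr rfl fun x _ => by rw [c.dev_comm y x]; ring
    _ = 0 := by rw [sum_pi_dev, mul_zero]

lemma gap₂_antitone : Antitone c.gap₂ := c.antitone_of_lap c.lap_gap₂ c.gap₁_antitone c.sum_pi_gap₁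

lemma gap₁_eq (x : Fin (n + 1)) :
    c.gap₁ x = c.pot (Fin.last n) x - c.potMean (Fin.last n) := by
  have h1 : c.green (Fin.last n) x (Fin.last n) = 0 := by rw [green_comm, green_self_left]
  have h2 : c.pot (Fin.last n) (Fin.last n) = 0 := c.potOf_self _ _
  rw [gap₁, dev, h1, h2]; ring

lemma gap₁_zero : c.gap₁ 0 = c.devTr := by
  have h2 : c.pot (Fin.last n) (Fin.last n) = 0 := c.potOf_self _ _
  rw [gap₁_eq, c.devTr_eq (Fin.last n), ← pot_zero_add_pot_last, h2]; ring

lemma two_mul_gap₂_zero : 2 * c.gap₂ 0 = c.devTr ^ 2 + c.devTrSq := by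
  have h2 : c.pot (Fin.last n) (Fin.last n) = 0 := c.potOf_self _ _
  have h3 : c.potOf (Fin.last n) (c.pot (Fin.last n)) (Fin.last n) = 0 := c.potOf_self _ _
  have h4 := c.variance_sum_eq_greenTrSq (Fin.last n)
  rw [h2, h3] at h4
  have h5 : c.gap₂ 0 = c.potOf (Fin.last n) (c.pot (Fin.last n)) 0
      - c.pot (Fin.last n) 0 * c.potMean (Fin.last n) - c.potSq (Fin.last n)
      + c.potMean (Fin.last n) ^ 2 := by
    have h : ∀ y, c.dev 0 y * (c.pi y * c.gap₁ y)
        = c.green (Fin.last n) 0 y * (c.pi y * c.pot (Fin.last n) y)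
          - c.potMean (Fin.last n) * (c.green (Fin.last n) 0 y * c.pi y)
          - c.pi y * c.pot (Fin.last n) y ^ 2
          + c.potMean (Fin.last n) * (c.pi y * c.pot (Fin.last n) y)
          + (c.potMean (Fin.last n) - c.pot (Fin.last n) 0) * (c.pi y * c.gap₁ y) :=
      fun y => by rw [gap₁_eq, dev]; ring
    simp only [gap₂, h, Finset.sum_add_distrib, Finset.sum_sub_distrib, ← Finset.mul_sum,
      sum_pi_gap₁]
    rw [← potOf, ← pot_eq, ← potSq, ← potMean]; ring
  rw [h5, c.devTr_eq (Fin.last n), c.devTrSq_eq (Fin.last n), ← pot_zero_add_pot_last, h2]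
  linarith

/-- The generator conjugated to a symmetric matrix. -/
def symGen : Matrix (Fin (n + 1)) (Fin (n + 1)) ℝ :=
  Matrix.of fun x y => √(c.pi x) * (1 - c.K) x y * (√(c.pi y))⁻¹

lemma sqrt_pi_pos (x : Fin (n + 1)) : 0 < √(c.pi x) := Real.sqrt_pos.mpr (c.pi_pos x)

lemma symGen_isHermitian : c.symGen.IsHermitian := by
  ext x y
  have hx := (c.sqrt_pi_pos x).ne'
  have hy := (c.sqrt_pi_pos y).ne'
  have h1 := Real.mul_self_sqrt (c.pi_pos x).le
  have h2 := Real.mul_self_sqrt (c.pi_pos y).le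
  have h3 : c.pi y * (1 - c.K) y x = c.pi x * (1 - c.K) x y := by
    rw [Matrix.sub_apply, Matrix.sub_apply, mul_sub, mul_sub, c.detailed_balance y x]
    by_cases h : x = y
    · rw [h]
    · rw [Matrix.one_apply_ne h, Matrix.one_apply_ne (Ne.symm h)]; ring
  simp only [symGen, Matrix.conjTranspose_apply, Matrix.of_apply, star_trivial]
  rw [← h1, ← h2] at h3
  field_simp
  nlinarith [h3]

lemma symGen_mulVec (f : Fin (n + 1) → ℝ) :
    c.symGen.mulVec (fun x => √(c.pi x) * f x) = fun x => √(c.pi x) * c.lap f x := by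
  funext x
  simp only [Matrix.mulVec, dotProduct, symGen, Matrix.of_apply, lap, Finset.mul_sum]
  refine Finset.sum_congr rfl fun y _ => ?_
  have hy := (c.sqrt_pi_pos y).ne'
  field_simp

/-- The spectral gap inequality. -/
lemma poincare {l : ℝ} (hl : IsSmallestNonzeroEig (1 - c.K) l) {f : Fin (n + 1) → ℝ}
    (hf : ∑ x, c.pi x * f x = 0) :
    l * ∑ x, c.pi x * f x ^ 2 ≤ ∑ x, c.pi x * (f x * c.lap f x) := by
  set B := c.symGen_isHermitian.eigenvectorBasis with hB
  set μ := c.symGen_isHermitian.eigenvalues with hμ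
  set F : EuclideanSpace ℝ (Fin (n + 1)) := WithLp.toLp 2 fun x => √(c.pi x) * f x with hF
  set G : EuclideanSpace ℝ (Fin (n + 1)) := WithLp.toLp 2 fun x => √(c.pi x) * c.lap f x with hG
  have inner_eq : ∀ u v : EuclideanSpace ℝ (Fin (n + 1)), inner ℝ u v = ∑ x, u x * v x := by
    intro u v
    rw [PiLp.inner_apply]
    exact Finset.sum_congr rfl fun x _ => by simp [mul_comm]
  have hFF : inner ℝ F F = ∑ x, c.pi x * f x ^ 2 := by
    rw [inner_eq]
    refine Finset.sum_congr rfl fun x _ => ?_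
    rw [← Real.mul_self_sqrt (c.pi_pos x).le]; simp only [hF]; ring_nf
  have hFG : inner ℝ F G = ∑ x, c.pi x * (f x * c.lap f x) := by
    rw [inner_eq]
    refine Finset.sum_congr rfl fun x _ => ?_
    rw [← Real.mul_self_sqrt (c.pi_pos x).le]; simp only [hF, hG]; ring_nf
  have hBG : ∀ i, inner ℝ (B i) G = μ i * inner ℝ (B i) F := by
    intro i
    have h1 : c.symGen.mulVec ⇑(B i) = μ i • ⇑(B i) :=
      c.symGen_isHermitian.mulVec_eigenvectorBasis i
    have h2 : (G : Fin (n + 1) → ℝ) = c.symGen.mulVec F := (c.symGen_mulVec f).symm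
    rw [inner_eq, inner_eq]
    have h3 : ∑ x, B i x * G x = (B i : Fin (n + 1) → ℝ) ⬝ᵥ c.symGen.mulVec F := by
      rw [← h2]; rfl
    rw [h3, Matrix.dotProduct_mulVec, ← Matrix.mulVec_transpose]
    have h4 : c.symGenᵀ = c.symGen := by
      have := c.symGen_isHermitian
      rwa [Matrix.IsHermitian, Matrix.conjTranspose_eq_transpose_of_trivial] at this
    rw [h4, h1, smul_dotProduct]; rfl
  have hsum1 := B.sum_inner_mul_inner F F
  have hsum2 := B.sum_inner_mul_inner F G
  rw [← hFF, ← hFG, ← hsum1, ← hsum2, Finset.mul_sum]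
  refine Finset.sum_le_sum fun i _ => ?_
  rw [hBG i, real_inner_comm F (B i)]
  set φ : Fin (n + 1) → ℝ := fun x => (√(c.pi x))⁻¹ * B i x with hφ
  have hBφ : (B i : Fin (n + 1) → ℝ) = fun x => √(c.pi x) * φ x := by
    funext x
    have hx := (c.sqrt_pi_pos x).ne'
    simp only [hφ]; field_simp
  have hlap : c.lap φ = μ i • φ := by
    have h1 : c.symGen.mulVec ⇑(B i) = μ i • ⇑(B i) :=
      c.symGen_isHermitian.mulVec_eigenvectorBasis i
    rw [hBφ, symGen_mulVec] at h1
    funext x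
    have h2 := congrFun h1 x
    simp only [Pi.smul_apply, smul_eq_mul] at h2 ⊢
    refine mul_left_cancel₀ (c.sqrt_pi_pos x).ne' ?_
    rw [h2]; ring
  have hφ0 : φ ≠ 0 := by
    intro h
    have : B i = 0 := by
      ext x
      have := congrFun hBφ x
      rw [h] at this
      simpa using this
    exact B.orthonormal.ne_zero i this
  by_cases hμ0 : μ i = 0
  · have hconst := c.eq_of_lap_eq_zero (f := φ) (by rw [hlap, hμ0, zero_smul])
    have : inner ℝ (B i) F = 0 := by
      rw [inner_eq]
      have : ∀ x, B i x * F x = φ 0 * (c.pi x * f x) := by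
        intro x
        have e := Real.mul_self_sqrt (c.pi_pos x).le
        rw [show B i x = √(c.pi x) * φ x from congrFun hBφ x, hconst x]
        simp only [hF]
        linear_combination φ 0 * f x * e
      simp only [this, ← Finset.mul_sum, hf, mul_zero]
    rw [real_inner_comm] at this
    rw [this]; simp
  · have hle : l ≤ μ i := hl.2.2 (μ i) ⟨φ, hφ0, hlap⟩ hμ0
    nlinarith [mul_self_nonneg (inner ℝ F (B i))]

lemma lap_sub_const (f : Fin (n + 1) → ℝ) (a : ℝ) : c.lap (fun x => f x - a) = c.lap f := by
  rw [lap_sub c f fun _ => a, lap_const, sub_zero]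

/-- The spectral gap inequality without centring. -/
lemma poincare_variance {l : ℝ} (hl : IsSmallestNonzeroEig (1 - c.K) l) (f : Fin (n + 1) → ℝ) :
    l * (∑ x, c.pi x * f x ^ 2 - (∑ x, c.pi x * f x) ^ 2) ≤ ∑ x, c.pi x * (f x * c.lap f x) := by
  set a := ∑ x, c.pi x * f x with ha
  have h := c.poincare hl (f := fun x => f x - a)
    (by simp only [mul_sub, Finset.sum_sub_distrib, ← Finset.sum_mul, c.pi_sum, ← ha]; ring)
  have h1 : ∑ x, c.pi x * (f x - a) ^ 2 = ∑ x, c.pi x * f x ^ 2 - a ^ 2 := by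
    have : ∀ x, c.pi x * (f x - a) ^ 2
        = c.pi x * f x ^ 2 - 2 * a * (c.pi x * f x) + c.pi x * a ^ 2 := fun x => by ring
    simp only [this, Finset.sum_add_distrib, Finset.sum_sub_distrib, ← Finset.mul_sum,
      ← Finset.sum_mul, c.pi_sum, ← ha]
    ring
  have h2 : ∑ x, c.pi x * ((f x - a) * c.lap f x) = ∑ x, c.pi x * (f x * c.lap f x) := by
    have : ∀ x, c.pi x * ((f x - a) * c.lap f x)
        = c.pi x * (f x * c.lap f x) - a * (c.pi x * c.lap f x) := fun x => by ring
    simp only [this, Finset.sum_sub_distrib, ← Finset.mul_sum, sum_pi_lap]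
    ring
  rw [c.lap_sub_const f a] at h
  rwa [h1, h2] at h

/-- A nontrivial eigenfunction for a nonzero eigenvalue. -/
lemma exists_eigenfunction {l : ℝ} (hl : IsSmallestNonzeroEig (1 - c.K) l) :
    ∃ φ : Fin (n + 1) → ℝ, φ ≠ 0 ∧ c.lap φ = l • φ := hl.1

lemma sum_pi_sq_pos {φ : Fin (n + 1) → ℝ} (h : φ ≠ 0) : 0 < ∑ x, c.pi x * φ x ^ 2 := by
  obtain ⟨x, hx⟩ := Function.ne_iff.mp h
  refine Finset.sum_pos' (fun y _ => mul_nonneg (c.pi_pos y).le (sq_nonneg _))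
    ⟨x, Finset.mem_univ _, mul_pos (c.pi_pos x) ?_⟩
  exact sq_pos_of_ne_zero hx

lemma smallestEig_pos {l : ℝ} (hl : IsSmallestNonzeroEig (1 - c.K) l) : 0 < l := by
  obtain ⟨φ, hφ, h⟩ := c.exists_eigenfunction hl
  have h1 := c.sum_pi_mul_lap_self_nonneg φ
  have h2 : ∑ x, c.pi x * (φ x * c.lap φ x) = l * ∑ x, c.pi x * φ x ^ 2 := by
    rw [h, Finset.mul_sum]
    exact Finset.sum_congr rfl fun x _ => by simp only [Pi.smul_apply, smul_eq_mul]; ring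
  rw [h2] at h1
  exact lt_of_le_of_ne (nonneg_of_mul_nonneg_left h1 (c.sum_pi_sq_pos hφ)) hl.2.1.symm

lemma mul_devTrSq_le {l : ℝ} (hl : IsSmallestNonzeroEig (1 - c.K) l) :
    l * c.devTrSq ≤ c.devTr := by
  have h : ∀ z, l * ∑ x, c.pi x * c.dev x z ^ 2 ≤ c.dev z z := by
    intro z
    have h0 : ∑ x, c.pi x * c.dev x z = 0 := by simp only [c.dev_comm _ z, sum_pi_dev]
    refine (c.poincare hl (f := fun x => c.dev x z) h0).trans_eq ?_
    have : ∀ x, c.pi x * (c.dev x z * c.lap (fun x => c.dev x z) x)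
        = (if x = z then c.dev x z else 0) - c.pi x * c.dev x z := by
      intro x
      rw [mul_left_comm, pi_mul_lap_dev]; split_ifs <;> ring
    simp only [this, Finset.sum_sub_distrib, h0]
    simp
  rw [devTrSq, devTr, Finset.mul_sum]
  refine Finset.sum_le_sum fun z _ => ?_
  have h1 : ∑ x, c.pi z * (c.pi x * c.dev z x ^ 2) = c.pi z * ∑ x, c.pi x * c.dev x z ^ 2 := by
    simp only [Finset.mul_sum, c.dev_comm z]
  rw [h1, mul_left_comm]
  exact mul_le_mul_of_nonneg_left (h z) (c.pi_pos z).le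

/-- Cauchy–Schwarz in `ℓ²(π)`. -/
lemma sq_sum_pi_le (f g : Fin (n + 1) → ℝ) :
    (∑ x, c.pi x * (f x * g x)) ^ 2 ≤ (∑ x, c.pi x * f x ^ 2) * ∑ x, c.pi x * g x ^ 2 := by
  have h := Finset.sum_mul_sq_le_sq_mul_sq Finset.univ (fun x => √(c.pi x) * f x)
    fun x => √(c.pi x) * g x
  have h1 : ∀ x, √(c.pi x) * f x * (√(c.pi x) * g x) = c.pi x * (f x * g x) := by
    intro x
    rw [← Real.mul_self_sqrt (c.pi_pos x).le]; ring_nf; simp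
  simpa only [h1, mul_pow, Real.sq_sqrt (c.pi_pos _).le] using h

lemma one_le_sq_mul_devTrSq {l : ℝ} (hl : IsSmallestNonzeroEig (1 - c.K) l) :
    1 ≤ l ^ 2 * c.devTrSq := by
  obtain ⟨φ, hφ, h⟩ := c.exists_eigenfunction hl
  have hmean : ∑ x, c.pi x * φ x = 0 := by
    have h1 := c.sum_pi_lap φ
    rw [h] at h1
    have h2 : ∑ x, c.pi x * (l • φ) x = l * ∑ x, c.pi x * φ x := by
      rw [Finset.mul_sum]
      exact Finset.sum_congr rfl fun x _ => by simp only [Pi.smul_apply, smul_eq_mul]; ring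
    rw [h2] at h1
    exact (mul_eq_zero.mp h1).resolve_left hl.2.1
  have hconv : ∀ z, l * ∑ x, c.pi x * (c.dev x z * φ x) = φ z := by
    intro z
    have h1 := c.sum_pi_mul_lap (fun x => c.dev x z) φ
    rw [h] at h1
    have h2 : ∑ x, c.pi x * (c.dev x z * (l • φ) x) = l * ∑ x, c.pi x * (c.dev x z * φ x) := by
      rw [Finset.mul_sum]
      exact Finset.sum_congr rfl fun x _ => by simp only [Pi.smul_apply, smul_eq_mul]; ring
    have h3 : ∀ x, c.pi x * (φ x * c.lap (fun x => c.dev x z) x)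
        = (if x = z then φ x else 0) - c.pi x * φ x := by
      intro x
      rw [mul_left_comm, pi_mul_lap_dev]; split_ifs <;> ring
    rw [← h2, h1]
    simp only [h3, Finset.sum_sub_distrib, hmean]
    simp
  have hle : ∀ z, φ z ^ 2 ≤ l ^ 2 * ((∑ x, c.pi x * c.dev z x ^ 2) * ∑ x, c.pi x * φ x ^ 2) := by
    intro z
    have := c.sq_sum_pi_le (fun x => c.dev x z) φ
    simp only [c.dev_comm z]
    calc φ z ^ 2 = l ^ 2 * (∑ x, c.pi x * (c.dev x z * φ x)) ^ 2 := by rw [← mul_pow, hconv]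
      _ ≤ _ := mul_le_mul_of_nonneg_left this (sq_nonneg l)
  have hpos := c.sum_pi_sq_pos hφ
  have htot : ∑ z, c.pi z * φ z ^ 2 ≤ l ^ 2 * c.devTrSq * ∑ x, c.pi x * φ x ^ 2 := by
    calc ∑ z, c.pi z * φ z ^ 2
        ≤ ∑ z, c.pi z * (l ^ 2 * ((∑ x, c.pi x * c.dev z x ^ 2) * ∑ x, c.pi x * φ x ^ 2)) :=
          Finset.sum_le_sum fun z _ => mul_le_mul_of_nonneg_left (hle z) (c.pi_pos z).le
      _ = _ := by
          generalize ∑ x, c.pi x * φ x ^ 2 = Q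
          rw [devTrSq, Finset.mul_sum, Finset.sum_mul]
          refine Finset.sum_congr rfl fun z _ => ?_
          rw [← Finset.mul_sum (f := fun x => c.pi x * c.dev z x ^ 2)]; ring
  by_contra hlt
  nlinarith [not_le.mp hlt]

/-- Bounds on the occupation of a region whose complement is not negligible. -/
lemma potOf_indicator_bounds {l δ : ℝ} (hl : IsSmallestNonzeroEig (1 - c.K) l) (hδ : 0 < δ)
    (M : Fin (n + 1)) (S : Fin (n + 1) → Prop) [DecidablePred S]
    (hS : ∑ x, (if S x then c.pi x else 0) ≤ 1 - δ)
    (hvan : ∀ x, ¬S x → c.potOf M (fun z => if S z then 1 else 0) x = 0) :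
    ∑ x, c.pi x * c.potOf M (fun z => if S z then 1 else 0) x ≤ 1 / (l * δ) ∧
    ∑ x, c.pi x * c.potOf M (fun z => if S z then 1 else 0) x ^ 2 ≤ (1 / (l * δ)) ^ 2 := by
  set f := c.potOf M (fun z => if S z then 1 else 0) with hf
  have hlpos := c.smallestEig_pos hl
  have hfS : ∀ x, f x * (if S x then 1 else 0) = f x := by
    intro x
    by_cases h : S x
    · simp [h]
    · simp [h, hvan x h]
  have hE : ∑ x, c.pi x * (f x * c.lap f x) = ∑ x, c.pi x * f x := by
    refine Finset.sum_congr rfl fun x _ => ?_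
    rw [mul_left_comm, hf, pi_mul_lap_potOf, ← hf, mul_sub, mul_left_comm, hfS]
    split_ifs with hx
    · rw [hx, hf, potOf_self]; ring
    · ring
  have hf0 : 0 ≤ ∑ x, c.pi x * f x := Finset.sum_nonneg fun x _ =>
    mul_nonneg (c.pi_pos x).le (c.potOf_nonneg M (fun z => by split_ifs <;> norm_num) x)
  have hq0 : 0 ≤ ∑ x, c.pi x * f x ^ 2 := Finset.sum_nonneg fun x _ =>
    mul_nonneg (c.pi_pos x).le (sq_nonneg _)
  have hCS : (∑ x, c.pi x * f x) ^ 2 ≤ (1 - δ) * ∑ x, c.pi x * f x ^ 2 := by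
    have h := c.sq_sum_pi_le f fun x => if S x then 1 else 0
    simp only [hfS] at h
    refine h.trans ?_
    rw [mul_comm]
    refine mul_le_mul_of_nonneg_right (le_of_eq_of_le ?_ hS) hq0
    exact Finset.sum_congr rfl fun x _ => by split_ifs <;> simp
  have hP := c.poincare_variance hl f
  rw [hE] at hP
  set m := ∑ x, c.pi x * f x
  set q := ∑ x, c.pi x * f x ^ 2
  have hld : 0 < l * δ := mul_pos hlpos hδ
  have h1 : l * δ * q ≤ m := by nlinarith
  have h2 : m ^ 2 ≤ q := by nlinarith
  have hm : m ≤ 1 / (l * δ) := by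
    rw [le_div_iff₀ hld]
    by_contra hlt
    have hlt := not_le.mp hlt
    have hmpos : 0 < m := pos_of_mul_pos_left (zero_lt_one.trans hlt) hld.le
    nlinarith [mul_pos hmpos (sub_pos.mpr hlt), mul_le_mul_of_nonneg_left h2 hld.le]
  refine ⟨hm, ?_⟩
  have h3 : q ≤ m / (l * δ) := by rw [le_div_iff₀ hld]; linarith
  calc q ≤ m / (l * δ) := h3
    _ ≤ 1 / (l * δ) / (l * δ) := by gcongr
    _ = _ := by rw [sq, div_div, div_mul_div_comm, one_mul]

lemma pot_bounds {l δ : ℝ} (hl : IsSmallestNonzeroEig (1 - c.K) l) (hδ : 0 < δ)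
    (M : Fin (n + 1)) (hlow : δ ≤ c.piLow M) (hhigh : δ ≤ c.piHigh M) :
    0 ≤ c.potMean M ∧ c.potMean M ≤ 2 / (l * δ) ∧ c.potMean M ^ 2 ≤ c.potSq M ∧
      c.potSq M ≤ 2 * (1 / (l * δ)) ^ 2 := by
  have hpot0 : ∀ x, 0 ≤ c.pot M x := c.potOf_nonneg M fun _ => zero_le_one
  have hCS := c.sq_sum_pi_le (c.pot M) fun _ => 1
  simp only [mul_one, one_pow, c.pi_sum] at hCS
  have hvanL : ∀ x, ¬x < M → c.potOf M (fun z => if z < M then 1 else 0) x = 0 := by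
    intro x hx
    refine Finset.sum_eq_zero fun z _ => ?_
    by_cases hz : z < M
    · rw [c.green_eq_zero M x z (Or.inr ⟨hz.le, not_lt.mp hx⟩), zero_mul]
    · simp [hz]
  have hvanH : ∀ x, ¬M < x → c.potOf M (fun z => if M < z then 1 else 0) x = 0 := by
    intro x hx
    refine Finset.sum_eq_zero fun z _ => ?_
    by_cases hz : M < z
    · rw [c.green_eq_zero M x z (Or.inl ⟨not_lt.mp hx, hz.le⟩), zero_mul]
    · simp [hz]
  have hL := c.potOf_indicator_bounds hl hδ M (· < M) (by
    have : ∑ x, (if x < M then c.pi x else 0) = 1 - c.piHigh M := by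
      rw [← c.pi_sum, piHigh, ← Finset.sum_sub_distrib]
      refine Finset.sum_congr rfl fun x _ => ?_
      by_cases h : x < M
      · simp [h, not_le.mpr h]
      · simp [h, not_lt.mp h]
    linarith) hvanL
  have hH := c.potOf_indicator_bounds hl hδ M (M < ·) (by
    have : ∑ x, (if M < x then c.pi x else 0) = 1 - c.piLow M := by
      rw [← c.pi_sum, piLow, ← Finset.sum_sub_distrib]
      refine Finset.sum_congr rfl fun x _ => ?_
      by_cases h : M < x
      · simp [h, not_le.mpr h]
      · simp [h, not_lt.mp h]
    linarith) hvanH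
  have hsum : ∀ x, c.pot M x = c.potOf M (fun z => if z < M then 1 else 0) x
      + c.potOf M (fun z => if M < z then 1 else 0) x := by
    intro x
    rw [pot, potOf, potOf, potOf, ← Finset.sum_add_distrib]
    refine Finset.sum_congr rfl fun z _ => ?_
    rcases lt_trichotomy z M with h | h | h
    · simp [h, h.not_gt]
    · rw [h, green_comm, green_self_left]; ring
    · simp [h, h.not_gt]
  have hprod : ∀ x, c.potOf M (fun z => if z < M then 1 else 0) x
      * c.potOf M (fun z => if M < z then 1 else 0) x = 0 := by
    intro x
    by_cases hx : x < M
    · rw [hvanH x hx.not_gt, mul_zero]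
    · rw [hvanL x hx, zero_mul]
  have hmean : c.potMean M = ∑ x, c.pi x * c.potOf M (fun z => if z < M then 1 else 0) x
      + ∑ x, c.pi x * c.potOf M (fun z => if M < z then 1 else 0) x := by
    simp only [potMean, hsum, mul_add, Finset.sum_add_distrib]
  have hsq : c.potSq M = ∑ x, c.pi x * c.potOf M (fun z => if z < M then 1 else 0) x ^ 2
      + ∑ x, c.pi x * c.potOf M (fun z => if M < z then 1 else 0) x ^ 2 := by
    rw [potSq, ← Finset.sum_add_distrib]
    refine Finset.sum_congr rfl fun x _ => ?_
    rw [hsum]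
    linear_combination 2 * c.pi x * hprod x
  refine ⟨Finset.sum_nonneg fun x _ => mul_nonneg (c.pi_pos x).le (hpot0 x), ?_, hCS, ?_⟩
  · have : 2 / (l * δ) = 1 / (l * δ) + 1 / (l * δ) := by ring
    rw [hmean, this]; exact add_le_add hL.1 hH.1
  · rw [hsq, two_mul]; exact add_le_add hL.2 hH.2

end BDChain

section Semigroup

open scoped Matrix.Norms.Operator

variable {ι : Type*} [Fintype ι] [DecidableEq ι]

/-- The semigroup `e^{-t(1-Q)}` generated by `Q - 1`. -/
def semi (Q : Matrix ι ι ℝ) (t : ℝ) : Matrix ι ι ℝ := NormedSpace.exp (t • (Q - 1))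

lemma semi_zero (Q : Matrix ι ι ℝ) : semi Q 0 = 1 := by
  simp [semi]

lemma semi_add (Q : Matrix ι ι ℝ) (s t : ℝ) : semi Q (s + t) = semi Q s * semi Q t := by
  rw [semi, add_smul]
  exact Matrix.exp_add_of_commute _ _ ((Commute.refl (Q - 1)).smul_left s |>.smul_right t)

lemma hasSum_semi (Q : Matrix ι ι ℝ) (t : ℝ) :
    HasSum (fun m : ℕ => (Real.exp (-t) * t ^ m / m.factorial) • Q ^ m) (semi Q t) := by
  have h1 : semi Q t = Real.exp (-t) • NormedSpace.exp (t • Q) := by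
    have h2 : t • (Q - 1) = algebraMap ℝ (Matrix ι ι ℝ) (-t) + t • Q := by
      rw [Algebra.algebraMap_eq_smul_one, smul_sub, neg_smul]; abel
    have h3 : NormedSpace.exp (algebraMap ℝ (Matrix ι ι ℝ) (-t)) =
        algebraMap ℝ (Matrix ι ι ℝ) (Real.exp (-t)) := by
      rw [Real.exp_eq_exp_ℝ]
      exact (NormedSpace.algebraMap_exp_comm _).symm
    rw [semi, h2, Matrix.exp_add_of_commute _ _ (Algebra.commute_algebraMap_left _ _), h3,
      Algebra.algebraMap_eq_smul_one, smul_one_mul]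
  rw [h1]
  refine ((NormedSpace.exp_series_hasSum_exp' (𝕂 := ℝ) (t • Q)).const_smul (Real.exp (-t))).congr_fun ?_
  intro m
  rw [_root_.smul_pow, smul_smul, smul_smul]
  congr 1
  ring

lemma hasSum_semi_mulVec (Q : Matrix ι ι ℝ) (t : ℝ) (w : ι → ℝ) (j : ι) :
    HasSum (fun m : ℕ => (Real.exp (-t) * t ^ m / m.factorial) * (Q ^ m *ᵥ w) j)
      ((semi Q t *ᵥ w) j) := by
  have hcont : Continuous fun A : Matrix ι ι ℝ => (A *ᵥ w) j :=
    (continuous_apply j).comp (continuous_id.matrix_mulVec continuous_const)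
  have := (hasSum_semi Q t).map
    (⟨⟨fun A : Matrix ι ι ℝ => (A *ᵥ w) j, by simp⟩, fun A B => by simp [add_mulVec]⟩ :
      Matrix ι ι ℝ →+ ℝ) hcont
  refine this.congr_fun fun m => ?_
  simp [smul_mulVec]

lemma hasSum_semi_apply (Q : Matrix ι ι ℝ) (t : ℝ) (i j : ι) :
    HasSum (fun m : ℕ => (Real.exp (-t) * t ^ m / m.factorial) * (Q ^ m) i j) (semi Q t i j) := by
  simpa using hasSum_semi_mulVec Q t (Pi.single j 1) i

lemma poissonWeight_nonneg {t : ℝ} (ht : 0 ≤ t) (m : ℕ) :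
    0 ≤ Real.exp (-t) * t ^ m / m.factorial := by positivity

lemma hasDerivAt_semi_mulVec (Q : Matrix ι ι ℝ) (w : ι → ℝ) (j : ι) (t : ℝ) :
    HasDerivAt (fun u => (semi Q u *ᵥ w) j) (-(semi Q t *ᵥ ((1 - Q) *ᵥ w)) j) t := by
  have h := hasDerivAt_exp_smul_const (𝕂 := ℝ) (Q - 1) t
  let L : Matrix ι ι ℝ →L[ℝ] ℝ := LinearMap.toContinuousLinearMap
    ⟨⟨fun A : Matrix ι ι ℝ => (A *ᵥ w) j, fun A B => by simp [add_mulVec]⟩,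
      fun a A => by simp [smul_mulVec]⟩
  have h2 := L.hasFDerivAt.comp_hasDerivAt t h
  refine h2.congr_deriv ?_
  change ((semi Q t * (Q - 1)) *ᵥ w) j = _
  rw [← mulVec_mulVec, ← neg_sub 1 Q, neg_mulVec, mulVec_neg, Pi.neg_apply]

lemma semi_mulVec_eigen (Q : Matrix ι ι ℝ) {w : ι → ℝ} {l : ℝ} (h : (1 - Q) *ᵥ w = l • w)
    (t : ℝ) : semi Q t *ᵥ w = Real.exp (-(l * t)) • w := by
  have h1 : Q *ᵥ w = (1 - l) • w := by
    rw [sub_mulVec, one_mulVec] at h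
    rw [sub_smul, one_smul, ← h]; abel
  have h2 : ∀ m : ℕ, Q ^ m *ᵥ w = (1 - l) ^ m • w := by
    intro m
    induction m with
    | zero => simp
    | succ m ih => rw [pow_succ, ← mulVec_mulVec, h1, mulVec_smul, ih, smul_smul, pow_succ, mul_comm]
  ext j
  have h3 := hasSum_semi_mulVec Q t w j
  have h4 := (NormedSpace.exp_series_hasSum_exp' (𝕂 := ℝ) (t * (1 - l))).mul_left
    (Real.exp (-t) * w j)
  rw [← Real.exp_eq_exp_ℝ] at h4
  have h5 : Real.exp (-t) * w j * Real.exp (t * (1 - l)) = Real.exp (-(l * t)) * w j := by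
    rw [mul_right_comm, ← Real.exp_add]; ring_nf
  rw [h5] at h4
  refine (h3.unique (h4.congr_fun fun m => ?_))
  rw [h2, Pi.smul_apply, smul_eq_mul, smul_eq_mul, mul_pow]
  ring

lemma semi_mulVec_nonneg {Q : Matrix ι ι ℝ} (hQ : ∀ i j, 0 ≤ Q i j) {t : ℝ} (ht : 0 ≤ t)
    {w : ι → ℝ} (hw : ∀ j, 0 ≤ w j) (j : ι) : 0 ≤ (semi Q t *ᵥ w) j := by
  have h : ∀ m : ℕ, ∀ j, 0 ≤ (Q ^ m *ᵥ w) j := by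
    intro m
    induction m with
    | zero => simpa using hw
    | succ m ih =>
      intro j
      rw [pow_succ', ← mulVec_mulVec]
      exact Finset.sum_nonneg fun k _ => mul_nonneg (hQ j k) (ih k)
  exact (hasSum_semi_mulVec Q t w j).nonneg fun m => mul_nonneg (poissonWeight_nonneg ht m) (h m j)

lemma semi_mulVec_mono {Q : Matrix ι ι ℝ} (hQ : ∀ i j, 0 ≤ Q i j) {t : ℝ} (ht : 0 ≤ t)
    {v w : ι → ℝ} (hvw : ∀ j, v j ≤ w j) (j : ι) : (semi Q t *ᵥ v) j ≤ (semi Q t *ᵥ w) j := by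
  have h := semi_mulVec_nonneg hQ ht (w := w - v) (fun j => sub_nonneg.mpr (hvw j)) j
  rw [mulVec_sub] at h
  exact sub_nonneg.mp h

end Semigroup

namespace BDChain

variable {n : ℕ} (c : BDChain n)

/-- The heat semigroup acting on functions. -/
def heat (t : ℝ) (f : Fin (n + 1) → ℝ) : Fin (n + 1) → ℝ := semi c.K t *ᵥ f

lemma Ht_eq (t : ℝ) (x y : Fin (n + 1)) : c.Ht t x y = semi c.K t x y :=
  (hasSum_semi_apply c.K t x y).tsum_eq

lemma heat_apply (t : ℝ) (f : Fin (n + 1) → ℝ) (x : Fin (n + 1)) :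
    c.heat t f x = ∑ y, c.Ht t x y * f y := by
  simp only [Ht_eq]; rfl

lemma heat_zero (f : Fin (n + 1) → ℝ) : c.heat 0 f = f := by
  rw [heat, semi_zero, one_mulVec]

lemma heat_add (s t : ℝ) (f : Fin (n + 1) → ℝ) : c.heat (s + t) f = c.heat s (c.heat t f) := by
  simp only [heat, semi_add, mulVec_mulVec]

lemma hasDerivAt_heat (f : Fin (n + 1) → ℝ) (x : Fin (n + 1)) (t : ℝ) :
    HasDerivAt (fun u => c.heat u f x) (-c.heat t (c.lap f) x) t :=
  hasDerivAt_semi_mulVec c.K f x t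

lemma heat_eigen {f : Fin (n + 1) → ℝ} {l : ℝ} (h : c.lap f = l • f) (t : ℝ) :
    c.heat t f = Real.exp (-(l * t)) • f :=
  semi_mulVec_eigen c.K h t

lemma heat_const (a t : ℝ) : c.heat t (fun _ => a) = fun _ => a := by
  have h : c.lap (fun _ => a) = (0 : ℝ) • fun _ => a := by rw [c.lap_const, zero_smul]
  simpa using c.heat_eigen h t

lemma sum_Ht (t : ℝ) (x : Fin (n + 1)) : ∑ y, c.Ht t x y = 1 := by
  simpa [heat_apply] using congrFun (c.heat_const 1 t) x

lemma Ht_nonneg {t : ℝ} (ht : 0 ≤ t) (x y : Fin (n + 1)) : 0 ≤ c.Ht t x y := by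
  have h := semi_mulVec_nonneg c.K_nonneg ht (w := Pi.single y 1)
    (fun j => by by_cases hj : j = y <;> simp [hj]) x
  simpa [Ht_eq] using h

lemma heat_mono {t : ℝ} (ht : 0 ≤ t) {f g : Fin (n + 1) → ℝ} (h : ∀ x, f x ≤ g x)
    (x : Fin (n + 1)) : c.heat t f x ≤ c.heat t g x :=
  semi_mulVec_mono c.K_nonneg ht h x

lemma pi_mul_K_pow (m : ℕ) (x y : Fin (n + 1)) :
    c.pi x * (c.K ^ m) x y = c.pi y * (c.K ^ m) y x := by
  induction m generalizing x y with
  | zero =>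
    by_cases h : x = y
    · subst h; rfl
    · simp [h, Ne.symm h]
  | succ m ih =>
    rw [pow_succ, Matrix.mul_apply, ← pow_succ, pow_succ', Matrix.mul_apply, Finset.mul_sum,
      Finset.mul_sum]
    refine Finset.sum_congr rfl fun z _ => ?_
    rw [← mul_assoc, ih, ← mul_assoc, ← c.detailed_balance, mul_right_comm]

lemma pi_mul_Ht (t : ℝ) (x y : Fin (n + 1)) : c.pi x * c.Ht t x y = c.pi y * c.Ht t y x := by
  simp only [Ht, ← tsum_mul_left]
  refine tsum_congr fun m => ?_
  rw [mul_left_comm, c.pi_mul_K_pow, mul_left_comm]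

lemma sum_pi_heat (t : ℝ) (f : Fin (n + 1) → ℝ) :
    ∑ x, c.pi x * c.heat t f x = ∑ x, c.pi x * f x := by
  simp only [heat_apply, Finset.mul_sum]
  rw [Finset.sum_comm]
  refine Finset.sum_congr rfl fun y _ => ?_
  simp only [← mul_assoc, c.pi_mul_Ht t _ y]
  rw [← Finset.sum_mul, ← Finset.mul_sum, c.sum_Ht, mul_one]

lemma lazy_antitone {f : Fin (n + 1) → ℝ} (hf : Antitone f) :
    Antitone (((2 : ℝ)⁻¹ • (1 + c.K)) *ᵥ f) := by
  have hval : ∀ x, (((2 : ℝ)⁻¹ • (1 + c.K)) *ᵥ f) x = f x - 2⁻¹ * c.lap f x := by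
    intro x
    simp only [lap, smul_mulVec, add_mulVec, sub_mulVec, one_mulVec, Pi.smul_apply, Pi.add_apply,
      Pi.sub_apply, smul_eq_mul]
    ring
  refine Fin.antitone_iff_succ_le.mpr fun i => ?_
  have hd : 0 ≤ f i.castSucc - f i.succ := sub_nonneg.mpr (hf (Fin.castSucc_lt_succ).le)
  have h1 : c.lap f i.castSucc ≤ f i.castSucc - f i.succ := by
    rw [lap_apply, ← one_mul (f i.castSucc - f i.succ), ← c.K_rowSum i.castSucc, Finset.sum_mul]
    refine Finset.sum_le_sum fun y _ => ?_
    by_cases hy : y ≤ i.succ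
    · exact mul_le_mul_of_nonneg_left (by linarith [hf hy]) (c.K_nonneg _ _)
    · have : c.K i.castSucc y = 0 := by
        apply c.K_eq_zero_of_lt
        have := Fin.lt_def.mp (not_le.mp hy)
        simpa using this
      simp [this]
  have h2 : -(f i.castSucc - f i.succ) ≤ c.lap f i.succ := by
    rw [lap_apply, ← one_mul (f i.castSucc - f i.succ), ← c.K_rowSum i.succ, Finset.sum_mul,
      ← Finset.sum_neg_distrib]
    refine Finset.sum_le_sum fun y _ => ?_
    by_cases hy : i.castSucc ≤ y
    · rw [← mul_neg]
      exact mul_le_mul_of_nonneg_left (by linarith [hf hy]) (c.K_nonneg _ _)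
    · have : c.K i.succ y = 0 := by
        apply c.K_eq_zero_of_gt
        have := Fin.lt_def.mp (not_le.mp hy)
        simpa using this
      simp [this]
  rw [hval, hval]
  linarith

lemma heat_antitone {f : Fin (n + 1) → ℝ} (hf : Antitone f) {t : ℝ} (ht : 0 ≤ t) :
    Antitone (c.heat t f) := by
  set A : Matrix (Fin (n + 1)) (Fin (n + 1)) ℝ := (2 : ℝ)⁻¹ • (1 + c.K) with hA
  have h1 : semi c.K t = semi A (2 * t) := by
    rw [semi, semi]
    congr 1
    rw [hA, mul_smul, smul_comm (2 : ℝ) t, smul_sub (2 : ℝ), smul_smul, mul_inv_cancel₀ two_ne_zero,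
      one_smul, two_smul, add_sub_add_left_eq_sub]
  have h2 : ∀ m : ℕ, Antitone (A ^ m *ᵥ f) := by
    intro m
    induction m with
    | zero => simpa using hf
    | succ m ih => rw [pow_succ', ← mulVec_mulVec]; exact c.lazy_antitone ih
  intro x y hxy
  rw [heat, h1]
  exact hasSum_le (fun m => mul_le_mul_of_nonneg_left (h2 m hxy)
    (poissonWeight_nonneg (by positivity) m)) (hasSum_semi_mulVec A (2 * t) f y)
    (hasSum_semi_mulVec A (2 * t) f x)

end BDChain

lemma le_of_hasDerivAt_nonneg {g g' : ℝ → ℝ} {p q : ℝ} (hpq : p ≤ q)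
    (h : ∀ t ∈ Set.Icc p q, HasDerivAt g (g' t) t) (h0 : ∀ t ∈ Set.Icc p q, 0 ≤ g' t) :
    g p ≤ g q := by
  refine monotoneOn_of_deriv_nonneg (convex_Icc p q)
    (fun t ht => (h t ht).continuousAt.continuousWithinAt)
    (fun t ht => (h t (interior_subset ht)).differentiableAt.differentiableWithinAt)
    (fun t ht => ?_) (Set.left_mem_Icc.mpr hpq) (Set.right_mem_Icc.mpr hpq) hpq
  rw [(h t (interior_subset ht)).deriv]
  exact h0 t (interior_subset ht)

section Chebyshev

variable {d f₁ f₂ : ℝ → ℝ} {T S : ℝ}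

/-- Chebyshev's inequality for the upper tail of a nonincreasing tail function `d` with
iterated tail integrals `f₁` and `f₂`. -/
lemma tail_mul_sq_le (hT : 0 ≤ T) (hd : AntitoneOn d (Set.Ici 0)) (hd1 : ∀ t, 0 ≤ t → d t ≤ 1)
    (h₁ : ∀ t, HasDerivAt f₁ (-d t) t) (h₂ : ∀ t, HasDerivAt f₂ (-f₁ t) t)
    (h₁n : ∀ t, 0 ≤ t → 0 ≤ f₁ t) (h₂n : ∀ t, 0 ≤ t → 0 ≤ f₂ t)
    (h₁0 : f₁ 0 = T) (h₂0 : 2 * f₂ 0 = T ^ 2 + S) {a : ℝ} (ha : 0 < a) :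
    d (T + a) * a ^ 2 ≤ S := by
  have hf₁ : ∀ t, 0 ≤ t → T - t ≤ f₁ t := by
    intro t ht
    have := le_of_hasDerivAt_nonneg (g := fun u => f₁ u + u) ht
      (fun u _ => (h₁ u).add (hasDerivAt_id u)) (fun u hu => by linarith [hd1 u hu.1])
    simp only [h₁0] at this
    linarith
  have hu : ∀ e u : ℝ, HasDerivAt (fun u : ℝ => e * u - u ^ 2 / 2) (e - u) u := by
    intro e u
    have := ((hasDerivAt_id u).const_mul e).sub (((hasDerivAt_id u).pow 2).div_const 2)
    refine this.congr_deriv ?_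
    simp
  have hA := le_of_hasDerivAt_nonneg (g := fun u => -f₂ u - (T * u - u ^ 2 / 2)) hT
    (fun u _ => (h₂ u).neg.sub (hu T u)) (fun u hu => by linarith [hf₁ u hu.1])
  have hδ : ∀ t ∈ Set.Icc T (T + a), d (T + a) * (T + a - t) ≤ f₁ t := by
    intro t ht
    have := le_of_hasDerivAt_nonneg (g := fun u => -f₁ u - d (T + a) * u) ht.2
      (fun u _ => (h₁ u).neg.sub ((hasDerivAt_id u).const_mul (d (T + a)))) (fun u hu => by
        have := hd (Set.mem_Ici.mpr (by linarith [hu.1, ht.1])) (Set.mem_Ici.mpr (by linarith)) hu.2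
        linarith)
    have h0 := h₁n (T + a) (by linarith)
    linarith
  have hB := le_of_hasDerivAt_nonneg
    (g := fun u => -f₂ u - d (T + a) * ((T + a) * u - u ^ 2 / 2)) (le_add_of_nonneg_right ha.le)
    (fun u _ => (h₂ u).neg.sub ((hu (T + a) u).const_mul (d (T + a))))
    (fun u hu => by linarith [hδ u hu])
  have h0 := h₂n (T + a) (by linarith)
  nlinarith

/-- Chebyshev's inequality for the lower tail of a nonincreasing tail function `d` with
iterated tail integrals `f₁` and `f₂`. -/
lemma one_sub_tail_mul_sq_le (hd : AntitoneOn d (Set.Ici 0)) (hd1 : ∀ t, 0 ≤ t → d t ≤ 1)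
    (h₁ : ∀ t, HasDerivAt f₁ (-d t) t) (h₂ : ∀ t, HasDerivAt f₂ (-f₁ t) t)
    (h₂n : ∀ t, 0 ≤ t → 0 ≤ f₂ t)
    (h₁0 : f₁ 0 = T) (h₂0 : 2 * f₂ 0 = T ^ 2 + S) {a : ℝ} (ha : 0 < a) (haT : a ≤ T) :
    (1 - d (T - a)) * a ^ 2 ≤ S := by
  have hf₁ : ∀ t, 0 ≤ t → T - t ≤ f₁ t := by
    intro t ht
    have := le_of_hasDerivAt_nonneg (g := fun u => f₁ u + u) ht
      (fun u _ => (h₁ u).add (hasDerivAt_id u)) (fun u hu => by linarith [hd1 u hu.1])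
    simp only [h₁0] at this
    linarith
  have hu : ∀ e u : ℝ, HasDerivAt (fun u : ℝ => e * u - u ^ 2 / 2) (e - u) u := by
    intro e u
    have := ((hasDerivAt_id u).const_mul e).sub (((hasDerivAt_id u).pow 2).div_const 2)
    refine this.congr_deriv ?_
    simp
  have hA := le_of_hasDerivAt_nonneg (g := fun u => -f₂ u - (T * u - u ^ 2 / 2))
    (sub_nonneg.mpr haT)
    (fun u _ => (h₂ u).neg.sub (hu T u)) (fun u hu => by linarith [hf₁ u hu.1])
  have hδ : ∀ t ∈ Set.Icc (T - a) T, a - d (T - a) * (t - (T - a)) ≤ f₁ t := by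
    intro t ht
    have := le_of_hasDerivAt_nonneg (g := fun u => f₁ u + d (T - a) * u) ht.1
      (fun u _ => (h₁ u).add ((hasDerivAt_id u).const_mul (d (T - a)))) (fun u hu => by
        have := hd (Set.mem_Ici.mpr (by linarith)) (Set.mem_Ici.mpr (by linarith [hu.1])) hu.1
        linarith)
    have h0 := hf₁ (T - a) (by linarith)
    linarith
  have hB := le_of_hasDerivAt_nonneg
    (g := fun u => -f₂ u - a * u - d (T - a) * ((T - a) * u - u ^ 2 / 2))
    (sub_le_self T ha.le)
    (fun u _ => ((h₂ u).neg.sub ((hasDerivAt_id u).const_mul a)).sub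
      ((hu (T - a) u).const_mul (d (T - a))))
    (fun u hu => by linarith [hδ u hu])
  have h0 := h₂n T (by linarith)
  nlinarith

end Chebyshev

namespace BDChain

variable {n : ℕ} (c : BDChain n)

lemma apply_zero_nonneg {f : Fin (n + 1) → ℝ} (hf : Antitone f) (h0 : ∑ x, c.pi x * f x = 0) :
    0 ≤ f 0 := by
  have h : ∑ x, c.pi x * f x ≤ ∑ x, c.pi x * f 0 :=
    Finset.sum_le_sum fun x _ => mul_le_mul_of_nonneg_left (hf (Fin.zero_le x)) (c.pi_pos x).le
  rwa [h0, ← Finset.sum_mul, c.pi_sum, one_mul] at h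

lemma heat_gap (t : ℝ) (x : Fin (n + 1)) :
    c.heat t c.gap x = 1 - c.Ht t x (Fin.last n) / c.pi (Fin.last n) := by
  simp only [heat_apply, gap, mul_sub, mul_one, Finset.sum_sub_distrib, sum_Ht, mul_ite, mul_zero,
    Finset.sum_ite_eq', Finset.mem_univ, if_true, div_eq_mul_inv]

lemma Ht_div_pi (t : ℝ) (x y : Fin (n + 1)) :
    c.Ht t x y / c.pi y = c.Ht t y x / c.pi x := by
  rw [div_eq_div_iff (c.pi_pos y).ne' (c.pi_pos x).ne', mul_comm, c.pi_mul_Ht, mul_comm]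

lemma Ht_zero_div_pi_antitone {t : ℝ} (ht : 0 ≤ t) : Antitone fun y => c.Ht t 0 y / c.pi y := by
  have h : Antitone (c.heat t (Pi.single 0 1)) := by
    refine c.heat_antitone (fun x y hxy => ?_) ht
    by_cases hx : x = 0
    · subst hx
      by_cases hy : y = 0 <;> simp [hy]
    · have hy : y ≠ 0 := fun hy => hx (le_antisymm (hy ▸ hxy) (Fin.zero_le x))
      simp [hx, hy]
  intro x y hxy
  have h2 := h hxy
  simp only [heat_apply, Pi.single_apply, mul_ite, mul_one, mul_zero, Finset.sum_ite_eq',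
    Finset.mem_univ, if_true] at h2
  simp only [c.Ht_div_pi t 0]
  exact div_le_div_of_nonneg_right h2 (c.pi_pos 0).le

lemma sepC_zero_eq {t : ℝ} (ht : 0 ≤ t) : c.sepC 0 t = c.heat t c.gap 0 := by
  rw [heat_gap, sepC]
  refine le_antisymm (ciSup_le fun y => ?_) (le_ciSup (f := fun y => 1 - c.Ht t 0 y / c.pi y)
    (Set.finite_range _).bddAbove (Fin.last n))
  exact sub_le_sub_left (c.Ht_zero_div_pi_antitone ht (Fin.le_last y)) 1

lemma sepC_antitoneOn : AntitoneOn (c.sepC 0) (Set.Ici 0) := by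
  intro s hs t ht hst
  rw [c.sepC_zero_eq hs, c.sepC_zero_eq ht]
  have h := c.heat_add (t - s) s c.gap
  rw [sub_add_cancel] at h
  rw [h]
  refine (c.heat_mono (sub_nonneg.mpr hst) (g := fun _ => c.heat s c.gap 0)
    (fun x => c.heat_antitone c.gap_antitone hs (Fin.zero_le x)) 0).trans_eq ?_
  rw [heat_const]

lemma sepC_le_one {t : ℝ} (ht : 0 ≤ t) : c.sepC 0 t ≤ 1 := by
  rw [c.sepC_zero_eq ht, heat_gap]
  linarith [div_nonneg (c.Ht_nonneg ht 0 (Fin.last n)) (c.pi_pos (Fin.last n)).le]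

lemma heat_zero_nonneg {f : Fin (n + 1) → ℝ} (hf : Antitone f) (h0 : ∑ x, c.pi x * f x = 0)
    {t : ℝ} (ht : 0 ≤ t) : 0 ≤ c.heat t f 0 :=
  c.apply_zero_nonneg (c.heat_antitone hf ht) (by rw [sum_pi_heat, h0])

lemma devTr_nonneg : 0 ≤ c.devTr := by
  rw [← c.gap₁_zero]
  exact c.apply_zero_nonneg c.gap₁_antitone c.sum_pi_gap₁

lemma devTrSq_nonneg : 0 ≤ c.devTrSq :=
  Finset.sum_nonneg fun x _ => Finset.sum_nonneg fun z _ =>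
    mul_nonneg (c.pi_pos x).le (mul_nonneg (c.pi_pos z).le (sq_nonneg _))

lemma heat_gap_antitoneOn : AntitoneOn (fun t => c.heat t c.gap 0) (Set.Ici 0) :=
  c.sepC_antitoneOn.congr fun _ ht => c.sepC_zero_eq ht

lemma sepC_upper_tail {a : ℝ} (ha : 0 < a) : c.sepC 0 (c.devTr + a) * a ^ 2 ≤ c.devTrSq := by
  have hT := c.devTr_nonneg
  rw [c.sepC_zero_eq (by linarith)]
  refine tail_mul_sq_le (d := fun t => c.heat t c.gap 0) (f₁ := fun t => c.heat t c.gap₁ 0)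
    (f₂ := fun t => c.heat t c.gap₂ 0) hT c.heat_gap_antitoneOn
    (fun t ht => by rw [← c.sepC_zero_eq ht]; exact c.sepC_le_one ht)
    (fun t => by simpa only [c.lap_gap₁] using c.hasDerivAt_heat c.gap₁ 0 t)
    (fun t => by simpa only [c.lap_gap₂] using c.hasDerivAt_heat c.gap₂ 0 t)
    (fun t ht => c.heat_zero_nonneg c.gap₁_antitone c.sum_pi_gap₁ ht)
    (fun t ht => c.heat_zero_nonneg c.gap₂_antitone c.sum_pi_gap₂ ht) ?_ ?_ ha
  · simp only [heat_zero, gap₁_zero]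
  · simp only [heat_zero, two_mul_gap₂_zero]

lemma sepC_lower_tail {a : ℝ} (ha : 0 < a) (haT : a ≤ c.devTr) :
    (1 - c.sepC 0 (c.devTr - a)) * a ^ 2 ≤ c.devTrSq := by
  rw [c.sepC_zero_eq (by linarith)]
  refine one_sub_tail_mul_sq_le (d := fun t => c.heat t c.gap 0)
    (f₁ := fun t => c.heat t c.gap₁ 0)
    (f₂ := fun t => c.heat t c.gap₂ 0) c.heat_gap_antitoneOn
    (fun t ht => by rw [← c.sepC_zero_eq ht]; exact c.sepC_le_one ht)
    (fun t => by simpa only [c.lap_gap₁] using c.hasDerivAt_heat c.gap₁ 0 t)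
    (fun t => by simpa only [c.lap_gap₂] using c.hasDerivAt_heat c.gap₂ 0 t)
    (fun t ht => c.heat_zero_nonneg c.gap₂_antitone c.sum_pi_gap₂ ht) ?_ ?_ ha haT
  · simp only [heat_zero, gap₁_zero]
  · simp only [heat_zero, two_mul_gap₂_zero]

lemma one_sub_sepC_le_Ht_zero {t : ℝ} (ht : 0 ≤ t) (y : Fin (n + 1)) :
    (1 - c.sepC 0 t) * c.pi y ≤ c.Ht t 0 y := by
  rw [← le_div_iff₀ (c.pi_pos y), c.sepC_zero_eq ht, heat_gap, sub_sub_cancel]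
  exact c.Ht_zero_div_pi_antitone ht (Fin.le_last y)

lemma one_sub_sepC_le_Ht_last {t : ℝ} (ht : 0 ≤ t) (y : Fin (n + 1)) :
    (1 - c.sepC 0 t) * c.pi y ≤ c.Ht t (Fin.last n) y := by
  rw [← le_div_iff₀ (c.pi_pos y), c.sepC_zero_eq ht, c.Ht_div_pi]
  have h := c.heat_antitone c.gap_antitone ht (Fin.zero_le y)
  rw [c.heat_gap t y] at h
  linarith

lemma heat_sub_le_sepC {f : Fin (n + 1) → ℝ} (h0 : ∀ x, 0 ≤ f x) (h1 : ∀ x, f x ≤ 1) {t : ℝ}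
    (ht : 0 ≤ t) : c.heat t f 0 - c.heat t f (Fin.last n) ≤ c.sepC 0 t := by
  have hA : (1 - c.sepC 0 t) * ∑ y, c.pi y * (1 - f y) ≤ ∑ y, c.Ht t 0 y * (1 - f y) := by
    rw [Finset.mul_sum]
    refine Finset.sum_le_sum fun y _ => ?_
    rw [← mul_assoc]
    exact mul_le_mul_of_nonneg_right (c.one_sub_sepC_le_Ht_zero ht y) (sub_nonneg.mpr (h1 y))
  have hB : (1 - c.sepC 0 t) * ∑ y, c.pi y * f y ≤ ∑ y, c.Ht t (Fin.last n) y * f y := by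
    rw [Finset.mul_sum]
    refine Finset.sum_le_sum fun y _ => ?_
    rw [← mul_assoc]
    exact mul_le_mul_of_nonneg_right (c.one_sub_sepC_le_Ht_last ht y) (h0 y)
  simp only [mul_sub, mul_one, Finset.sum_sub_distrib, c.pi_sum, c.sum_Ht, ← heat_apply] at hA hB
  linarith

/-- The total variation of a function along the path `0, 1, ..., n`. -/
def pathVar (f : Fin (n + 1) → ℝ) : ℝ := ∑ i : Fin n, |f i.castSucc - f i.succ|

lemma eq_sum_indicators (f : Fin (n + 1) → ℝ) (x : Fin (n + 1)) :
    f x = f (Fin.last n) +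
      ∑ i : Fin n, (f i.castSucc - f i.succ) * if x ≤ i.castSucc then 1 else 0 := by
  induction x using Fin.reverseInduction with
  | last =>
    rw [Finset.sum_eq_zero, add_zero]
    intro i _
    simp
  | cast j ih =>
    have h : ∀ i : Fin n, (f i.castSucc - f i.succ) * (if j.castSucc ≤ i.castSucc then 1 else 0) =
        (f i.castSucc - f i.succ) * (if j.succ ≤ i.castSucc then 1 else 0) +
          if i = j then f i.castSucc - f i.succ else 0 := by
      intro i
      rcases lt_trichotomy i j with h | h | h
      · have h1 : ¬ j.castSucc ≤ i.castSucc := by simpa using h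
        have h2 : ¬ j.succ ≤ i.castSucc := fun h' => h1 (Fin.castSucc_lt_succ.le.trans h')
        simp [h1, h2, h.ne]
      · subst h
        simp
      · have h2 : j.succ ≤ i.castSucc := by rw [Fin.le_def]; simpa using h
        have h1 : j.castSucc ≤ i.castSucc := Fin.castSucc_lt_succ.le.trans h2
        simp [h1, h2, h.ne']
    rw [Finset.sum_congr rfl fun i _ => h i, Finset.sum_add_distrib, ← add_assoc, ← ih]
    simp

lemma pathVar_heat_le (f : Fin (n + 1) → ℝ) {t : ℝ} (ht : 0 ≤ t) :
    pathVar (c.heat t f) ≤ c.sepC 0 t * pathVar f := by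
  set e : Fin n → Fin (n + 1) → ℝ := fun i x => if x ≤ i.castSucc then 1 else 0 with he
  have hanti : ∀ i, Antitone (e i) := by
    intro i x y hxy
    simp only [he]
    by_cases hy : y ≤ i.castSucc
    · simp [hy, hxy.trans hy]
    · simp only [hy, if_false]; split_ifs <;> norm_num
  have hdec : ∀ x, c.heat t f x =
      f (Fin.last n) + ∑ i, (f i.castSucc - f i.succ) * c.heat t (e i) x := by
    intro x
    rw [heat_apply]
    simp only [c.heat_apply t (e _) x, Finset.mul_sum]
    rw [Finset.sum_comm]
    nth_rw 1 [← mul_one (f (Fin.last n)), ← c.sum_Ht t x, Finset.mul_sum,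
      ← Finset.sum_add_distrib]
    refine Finset.sum_congr rfl fun y _ => ?_
    rw [eq_sum_indicators f y, mul_add, Finset.mul_sum, mul_comm]
    exact congrArg₂ _ rfl (Finset.sum_congr rfl fun i _ => mul_left_comm _ _ _)
  have hpt : ∀ j : Fin n, |c.heat t f j.castSucc - c.heat t f j.succ| ≤
      ∑ i : Fin n, |f i.castSucc - f i.succ| *
        (c.heat t (e i) j.castSucc - c.heat t (e i) j.succ) := by
    intro j
    rw [hdec, hdec, add_sub_add_left_eq_sub, ← Finset.sum_sub_distrib]
    refine (Finset.abs_sum_le_sum_abs _ _).trans (Finset.sum_le_sum fun i _ => ?_)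
    rw [← mul_sub, abs_mul, abs_of_nonneg (sub_nonneg.mpr
      (c.heat_antitone (hanti i) ht Fin.castSucc_lt_succ.le))]
  refine (Finset.sum_le_sum fun j _ => hpt j).trans ?_
  rw [Finset.sum_comm, pathVar, Finset.mul_sum]
  refine Finset.sum_le_sum fun i _ => ?_
  rw [← Finset.mul_sum, sum_castSucc_sub_succ, mul_comm]
  refine mul_le_mul_of_nonneg_right (c.heat_sub_le_sepC (fun x => ?_) (fun x => ?_) ht)
    (abs_nonneg _)
  · simp only [he]; split_ifs <;> norm_num
  · simp only [he]; split_ifs <;> norm_num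

lemma exp_le_sepC {l : ℝ} (hl : IsSmallestNonzeroEig (1 - c.K) l) {t : ℝ} (ht : 0 ≤ t) :
    Real.exp (-(l * t)) ≤ c.sepC 0 t := by
  obtain ⟨φ, hφ, hlap⟩ := c.exists_eigenfunction hl
  have h := c.pathVar_heat_le φ ht
  rw [c.heat_eigen hlap] at h
  have h2 : pathVar (Real.exp (-(l * t)) • φ) = Real.exp (-(l * t)) * pathVar φ := by
    simp only [pathVar, Pi.smul_apply, smul_eq_mul, ← mul_sub, abs_mul, Real.abs_exp,
      Finset.mul_sum]
  rw [h2] at h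
  refine le_of_mul_le_mul_right h ?_
  refine lt_of_le_of_ne (Finset.sum_nonneg fun i _ => abs_nonneg _) fun h0 => hφ ?_
  have hz : ∀ i : Fin n, φ i.castSucc - φ i.succ = 0 := fun i =>
    abs_eq_zero.mp ((Finset.sum_eq_zero_iff_of_nonneg fun i _ => abs_nonneg _).mp h0.symm i
      (Finset.mem_univ i))
  have hconst : φ = fun _ => φ (Fin.last n) := by
    ext x
    rw [eq_sum_indicators φ x]
    simp [hz]
  rw [hconst, c.lap_const] at hlap
  rw [hconst]
  rcases smul_eq_zero.mp hlap.symm with h | h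
  · exact absurd h hl.2.1
  · exact h

/-- The indicator function of the complement of the state `M`. -/
def offInd (M : Fin (n + 1)) (x : Fin (n + 1)) : ℝ := if x = M then 0 else 1

lemma offInd_nonneg (M x : Fin (n + 1)) : 0 ≤ offInd M x := by
  rw [offInd]; split_ifs <;> norm_num

lemma killed_nonneg (M i j : Fin (n + 1)) : 0 ≤ c.killed M i j := by
  simp only [killed, Matrix.of_apply]
  split_ifs
  · exact le_rfl
  · exact c.K_nonneg i j

lemma hitSurv_eq (M j : Fin (n + 1)) (m : ℕ) : c.hitSurv M j m = (c.killed M ^ m *ᵥ offInd M) j := by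
  cases m with
  | zero => simp [hitSurv, offInd, Matrix.one_apply]
  | succ m =>
    rw [hitSurv]
    split_ifs with hj
    · rw [pow_succ', ← mulVec_mulVec]
      rw [mulVec_apply_eq_sum]
      refine (Finset.sum_eq_zero fun y _ => ?_).symm
      simp [killed, hj]
    · rw [mulVec_apply_eq_sum]
      refine Finset.sum_congr rfl fun y _ => ?_
      by_cases hy : y = M
      · have h0 : (c.killed M ^ (m + 1)) j y = 0 := by
          rw [pow_succ, Matrix.mul_apply]
          exact Finset.sum_eq_zero fun z _ => by simp [killed, hy]
        rw [h0, zero_mul]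
      · simp [offInd, hy]

lemma hitSurvC_eq (M j : Fin (n + 1)) (t : ℝ) :
    c.hitSurvC M j t = (semi (c.killed M) t *ᵥ offInd M) j := by
  simp only [hitSurvC, hitSurv_eq]
  exact (hasSum_semi_mulVec (c.killed M) t (offInd M) j).tsum_eq

lemma one_sub_killed_mulVec_potOf (M : Fin (n + 1)) (f : Fin (n + 1) → ℝ) :
    (1 - c.killed M) *ᵥ c.potOf M f = fun x => if x = M then 0 else f x := by
  ext x
  rw [sub_mulVec, one_mulVec, Pi.sub_apply]
  split_ifs with hx
  · subst hx
    rw [c.potOf_self, zero_sub, neg_eq_zero, mulVec_apply_eq_sum]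
    exact Finset.sum_eq_zero fun y _ => by simp [killed]
  · rw [← c.lap_potOf M f hx, lap, sub_mulVec, one_mulVec, Pi.sub_apply]
    congr 1
    rw [mulVec_apply_eq_sum, mulVec_apply_eq_sum]
    refine Finset.sum_congr rfl fun y _ => ?_
    by_cases hy : y = M
    · subst hy
      rw [c.potOf_self, mul_zero, mul_zero]
    · simp [killed, hx, hy]

lemma one_sub_killed_mulVec_pot (M : Fin (n + 1)) :
    (1 - c.killed M) *ᵥ c.pot M = offInd M :=
  c.one_sub_killed_mulVec_potOf M _

lemma pot_self (M : Fin (n + 1)) : c.pot M M = 0 := c.potOf_self M _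

lemma pot_nonneg (M x : Fin (n + 1)) : 0 ≤ c.pot M x := c.potOf_nonneg M (fun _ => zero_le_one) x

lemma one_sub_killed_mulVec_potOf_pot (M : Fin (n + 1)) :
    (1 - c.killed M) *ᵥ c.potOf M (c.pot M) = c.pot M := by
  rw [one_sub_killed_mulVec_potOf]
  ext x
  split_ifs with hx
  · rw [hx, pot_self]
  · rfl

/-- The expected remaining hitting time of `M` after time `t`. -/
def tailMean (M j : Fin (n + 1)) (t : ℝ) : ℝ := (semi (c.killed M) t *ᵥ c.pot M) j

/-- The integral over `[t, ∞)` of the expected remaining hitting time of `M`. -/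
def tailMeanInt (M j : Fin (n + 1)) (t : ℝ) : ℝ :=
  (semi (c.killed M) t *ᵥ c.potOf M (c.pot M)) j

lemma hasDerivAt_tailMean (M j : Fin (n + 1)) (t : ℝ) :
    HasDerivAt (c.tailMean M j) (-c.hitSurvC M j t) t := by
  have h := hasDerivAt_semi_mulVec (c.killed M) (c.pot M) j t
  rwa [one_sub_killed_mulVec_pot, ← hitSurvC_eq] at h

lemma hasDerivAt_tailMeanInt (M j : Fin (n + 1)) (t : ℝ) :
    HasDerivAt (c.tailMeanInt M j) (-c.tailMean M j t) t := by
  have h := hasDerivAt_semi_mulVec (c.killed M) (c.potOf M (c.pot M)) j t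
  rwa [one_sub_killed_mulVec_potOf_pot] at h

lemma exists_pot_le (M : Fin (n + 1)) : ∃ C > 0, ∀ x, c.pot M x ≤ C * offInd M x := by
  obtain ⟨C, hC⟩ := (Set.finite_range (c.pot M)).bddAbove
  refine ⟨max C 1, lt_max_of_lt_right one_pos, fun x => ?_⟩
  rw [offInd]
  split_ifs with hx
  · rw [hx, pot_self, mul_zero]
  · rw [mul_one]
    exact (hC (Set.mem_range_self x)).trans (le_max_left _ _)

lemma hitSurvC_nonneg (M j : Fin (n + 1)) {t : ℝ} (ht : 0 ≤ t) : 0 ≤ c.hitSurvC M j t := by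
  rw [hitSurvC_eq]
  exact semi_mulVec_nonneg (c.killed_nonneg M) ht (offInd_nonneg M) j

lemma tailMean_nonneg (M j : Fin (n + 1)) {t : ℝ} (ht : 0 ≤ t) : 0 ≤ c.tailMean M j t :=
  semi_mulVec_nonneg (c.killed_nonneg M) ht (c.pot_nonneg M) j

lemma tailMeanInt_nonneg (M j : Fin (n + 1)) {t : ℝ} (ht : 0 ≤ t) : 0 ≤ c.tailMeanInt M j t :=
  semi_mulVec_nonneg (c.killed_nonneg M) ht (c.potOf_nonneg M (c.pot_nonneg M)) j

lemma tailMean_zero (M j : Fin (n + 1)) : c.tailMean M j 0 = c.pot M j := by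
  rw [tailMean, semi_zero, one_mulVec]

lemma tailMeanInt_zero (M j : Fin (n + 1)) : c.tailMeanInt M j 0 = c.potOf M (c.pot M) j := by
  rw [tailMeanInt, semi_zero, one_mulVec]

lemma exists_tail_bounds (M j : Fin (n + 1)) : ∃ C > 0, ∀ t, 0 ≤ t →
    c.tailMean M j t ≤ Real.exp (-(C⁻¹ * t)) * c.pot M j ∧
      c.tailMeanInt M j t ≤ C * c.tailMean M j t := by
  obtain ⟨C, hC, hpot⟩ := c.exists_pot_le M
  refine ⟨C, hC, fun t ht => ⟨?_, ?_⟩⟩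
  · have hle : ∀ u, 0 ≤ u → C⁻¹ * c.tailMean M j u ≤ c.hitSurvC M j u := by
      intro u hu
      rw [hitSurvC_eq, inv_mul_le_iff₀ hC, ← smul_eq_mul, ← Pi.smul_apply, ← mulVec_smul]
      exact semi_mulVec_mono (c.killed_nonneg M) hu hpot j
    have h := le_of_hasDerivAt_nonneg (g := fun u => -(Real.exp (C⁻¹ * u) * c.tailMean M j u)) ht
      (fun u _ => ((((hasDerivAt_id u).const_mul C⁻¹).exp).mul (c.hasDerivAt_tailMean M j u)).neg)
      (fun u hu => by
        have := mul_nonneg (Real.exp_pos (C⁻¹ * u)).le (sub_nonneg.mpr (hle u hu.1))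
        simp only [id_eq]
        linarith)
    rw [mul_zero, Real.exp_zero, one_mul, tailMean_zero, neg_le_neg_iff] at h
    rwa [Real.exp_neg, ← div_eq_inv_mul, le_div_iff₀' (Real.exp_pos _)]
  · rw [tailMeanInt, tailMean, ← smul_eq_mul, ← Pi.smul_apply, ← mulVec_smul]
    refine semi_mulVec_mono (c.killed_nonneg M) ht (fun x => ?_) j
    rw [Pi.smul_apply, smul_eq_mul, pot_eq, potOf, Finset.mul_sum]
    refine Finset.sum_le_sum fun z _ => ?_
    rw [← mul_assoc, mul_comm C]
    refine mul_le_mul_of_nonneg_left ((hpot z).trans ?_)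
      (mul_nonneg (c.green_nonneg M x z) (c.pi_pos z).le)
    rw [offInd]
    split_ifs
    · rw [mul_zero]; exact hC.le
    · rw [mul_one]

lemma tendsto_mul_exp_neg {C : ℝ} (hC : 0 < C) :
    Tendsto (fun t : ℝ => t * Real.exp (-(C⁻¹ * t))) atTop (nhds 0) := by
  have h := (Real.tendsto_pow_mul_exp_neg_atTop_nhds_zero 1).comp
    (tendsto_id.const_mul_atTop (inv_pos.mpr hC))
  have h2 := h.const_mul C
  rw [mul_zero] at h2
  refine h2.congr fun t => ?_
  simp only [Function.comp_apply, id_eq, pow_one]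
  rw [← mul_assoc, mul_inv_cancel_left₀ hC.ne']

lemma tendsto_tailMean_mul (M j : Fin (n + 1)) :
    Tendsto (fun t => t * c.tailMean M j t) atTop (nhds 0) := by
  obtain ⟨C, hC, hb⟩ := c.exists_tail_bounds M j
  have h := (tendsto_mul_exp_neg hC).mul_const (c.pot M j)
  rw [zero_mul] at h
  refine squeeze_zero' ?_ ?_ h
  · filter_upwards [eventually_ge_atTop 0] with t ht using mul_nonneg ht (c.tailMean_nonneg M j ht)
  · filter_upwards [eventually_ge_atTop 0] with t ht
    rw [mul_assoc]
    exact mul_le_mul_of_nonneg_left (hb t ht).1 ht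

lemma tendsto_tailMean (M j : Fin (n + 1)) : Tendsto (c.tailMean M j) atTop (nhds 0) := by
  refine squeeze_zero' ?_ ?_ (c.tendsto_tailMean_mul M j)
  · filter_upwards [eventually_ge_atTop 0] with t ht using c.tailMean_nonneg M j ht
  · filter_upwards [eventually_ge_atTop 1] with t ht
    exact le_mul_of_one_le_left (c.tailMean_nonneg M j (zero_le_one.trans ht)) ht

lemma tendsto_tailMeanInt (M j : Fin (n + 1)) : Tendsto (c.tailMeanInt M j) atTop (nhds 0) := by
  obtain ⟨C, hC, hb⟩ := c.exists_tail_bounds M j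
  have h := (c.tendsto_tailMean M j).const_mul C
  rw [mul_zero] at h
  refine squeeze_zero' ?_ ?_ h
  · filter_upwards [eventually_ge_atTop 0] with t ht using c.tailMeanInt_nonneg M j ht
  · filter_upwards [eventually_ge_atTop 0] with t ht using (hb t ht).2

lemma hitMeanC_eq (M j : Fin (n + 1)) : c.hitMeanC M j = c.pot M j := by
  have h := integral_Ioi_of_hasDerivAt_of_nonneg' (a := 0) (g := fun t => -c.tailMean M j t)
    (fun t _ => (c.hasDerivAt_tailMean M j t).neg)
    (fun t ht => by rw [neg_neg]; exact c.hitSurvC_nonneg M j (Set.mem_Ioi.mp ht).le)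
    (c.tendsto_tailMean M j).neg
  simpa [tailMean_zero, hitMeanC] using h

lemma hitVarC_eq (M j : Fin (n + 1)) :
    c.hitVarC M j = 2 * c.potOf M (c.pot M) j - c.pot M j ^ 2 := by
  rw [hitVarC, hitMeanC_eq]
  congr 1
  have hlim : Tendsto (fun t => -2 * (t * c.tailMean M j t + c.tailMeanInt M j t)) atTop
      (nhds 0) := by
    simpa using ((c.tendsto_tailMean_mul M j).add (c.tendsto_tailMeanInt M j)).const_mul (-2)
  have h := integral_Ioi_of_hasDerivAt_of_nonneg' (a := 0)
    (g := fun t => -2 * (t * c.tailMean M j t + c.tailMeanInt M j t))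
    (g' := fun t => 2 * t * c.hitSurvC M j t)
    (fun t _ => by
      refine ((((hasDerivAt_id t).mul (c.hasDerivAt_tailMean M j t)).add
        (c.hasDerivAt_tailMeanInt M j t)).const_mul (-2)).congr_deriv ?_
      simp only [id_eq]
      ring)
    (fun t ht => mul_nonneg (mul_nonneg zero_le_two (Set.mem_Ioi.mp ht).le)
      (c.hitSurvC_nonneg M j (Set.mem_Ioi.mp ht).le))
    hlim
  rw [h, tailMeanInt_zero]
  ring

lemma hitMeanC_zero_add_hitMeanC_last (M : Fin (n + 1)) :
    c.hitMeanC M 0 + c.hitMeanC M (Fin.last n) = c.greenTr M := by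
  rw [hitMeanC_eq, hitMeanC_eq, pot_zero_add_pot_last]

lemma hitVarC_zero_add_hitVarC_last (M : Fin (n + 1)) :
    c.hitVarC M 0 + c.hitVarC M (Fin.last n) = c.greenTrSq M := by
  rw [hitVarC_eq, hitVarC_eq, variance_sum_eq_greenTrSq]

lemma mixC_sepC_le {ε a : ℝ} (ha : 0 < a) (h : c.devTrSq ≤ ε * a ^ 2) :
    mixC (c.sepC 0) ε ≤ c.devTr + a := by
  refine csInf_le ⟨0, fun t ht => ht.1⟩ ⟨add_nonneg c.devTr_nonneg ha.le, ?_⟩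
  exact le_of_mul_le_mul_right ((c.sepC_upper_tail ha).trans h) (by positivity)

lemma exists_sepC_le {ε : ℝ} (hε : 0 < ε) : {t : ℝ | 0 ≤ t ∧ c.sepC 0 t ≤ ε}.Nonempty := by
  have hS := c.devTrSq_nonneg
  have ha : 0 < √((c.devTrSq + 1) / ε) := Real.sqrt_pos.mpr (by positivity)
  refine ⟨c.devTr + √((c.devTrSq + 1) / ε), add_nonneg c.devTr_nonneg ha.le, ?_⟩
  refine le_of_mul_le_mul_right ((c.sepC_upper_tail ha).trans ?_) (sq_pos_of_pos ha)
  rw [Real.sq_sqrt (by positivity), mul_div_cancel₀ _ hε.ne']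
  linarith

lemma le_mixC_sepC {ε a : ℝ} (hε : 0 < ε) (hε1 : ε < 1) (ha : 0 < a)
    (h : c.devTrSq < (1 - ε) * a ^ 2) : c.devTr - a ≤ mixC (c.sepC 0) ε := by
  refine le_csInf (c.exists_sepC_le hε) fun t ht => ?_
  by_contra! hlt
  have h1 := c.sepC_lower_tail (a := c.devTr - t) (by linarith) (by linarith [ht.1])
  rw [sub_sub_cancel] at h1
  have h2 : a ^ 2 ≤ (c.devTr - t) ^ 2 := pow_le_pow_left₀ ha.le (by linarith) 2
  have h3 : (1 - ε) * a ^ 2 ≤ (1 - c.sepC 0 t) * (c.devTr - t) ^ 2 :=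
    mul_le_mul (by linarith [ht.2]) h2 (sq_nonneg a) (by linarith [ht.2])
  linarith

lemma neg_log_le_mul_mixC {l : ℝ} (hl : IsSmallestNonzeroEig (1 - c.K) l) {ε : ℝ} (hε : 0 < ε) :
    -Real.log ε ≤ l * mixC (c.sepC 0) ε := by
  have hl0 := c.smallestEig_pos hl
  rw [← div_le_iff₀' hl0]
  refine le_csInf (c.exists_sepC_le hε) fun t ht => ?_
  rw [div_le_iff₀' hl0, neg_le]
  exact (Real.le_log_iff_exp_le hε).mpr ((c.exp_le_sepC hl ht.1).trans ht.2)

section Comparison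

variable {l δ : ℝ} {M : Fin (n + 1)}

lemma one_le_mul_sqrt_devTrSq (hl : IsSmallestNonzeroEig (1 - c.K) l) :
    1 ≤ l * √c.devTrSq := by
  have hl0 := c.smallestEig_pos hl
  rw [← abs_of_nonneg (mul_nonneg hl0.le (Real.sqrt_nonneg _)), ← one_le_sq_iff_one_le_abs,
    mul_pow, Real.sq_sqrt c.devTrSq_nonneg]
  exact c.one_le_sq_mul_devTrSq hl

lemma devTr_le_greenTr (hl : IsSmallestNonzeroEig (1 - c.K) l) (hδ : 0 < δ)
    (hlow : δ ≤ c.piLow M) (hhigh : δ ≤ c.piHigh M) :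
    c.devTr ≤ c.greenTr M := by
  linarith [c.devTr_eq M, (c.pot_bounds hl hδ M hlow hhigh).1]

lemma devTrSq_le_greenTrSq (hl : IsSmallestNonzeroEig (1 - c.K) l) (hδ : 0 < δ)
    (hlow : δ ≤ c.piLow M) (hhigh : δ ≤ c.piHigh M) :
    c.devTrSq ≤ c.greenTrSq M := by
  have h := c.pot_bounds hl hδ M hlow hhigh
  nlinarith [c.devTrSq_eq M, h.2.2.1, sq_nonneg (c.potMean M)]

lemma one_le_mul_sqrt_greenTrSq (hl : IsSmallestNonzeroEig (1 - c.K) l) (hδ : 0 < δ)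
    (hlow : δ ≤ c.piLow M) (hhigh : δ ≤ c.piHigh M) :
    1 ≤ l * √(c.greenTrSq M) :=
  (c.one_le_mul_sqrt_devTrSq hl).trans (mul_le_mul_of_nonneg_left
    (Real.sqrt_le_sqrt (c.devTrSq_le_greenTrSq hl hδ hlow hhigh)) (c.smallestEig_pos hl).le)

lemma sq_mul_sqrt_greenTrSq_le (hl : IsSmallestNonzeroEig (1 - c.K) l) (hδ : 0 < δ)
    (hlow : δ ≤ c.piLow M) (hhigh : δ ≤ c.piHigh M) :
    (l * √(c.greenTrSq M)) ^ 2 ≤ c.greenTr M * l + 4 / δ ^ 2 := by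
  have hl0 := c.smallestEig_pos hl
  have h := c.pot_bounds hl hδ M hlow hhigh
  have hT := c.devTr_le_greenTr hl hδ hlow hhigh
  have h0 := c.devTrSq_nonneg.trans (c.devTrSq_le_greenTrSq hl hδ hlow hhigh)
  rw [mul_pow, Real.sq_sqrt h0]
  have h1 : c.greenTrSq M ≤ c.devTrSq + 4 * (1 / (l * δ)) ^ 2 := by
    nlinarith [c.devTrSq_eq M, h.2.2.1, h.2.2.2, sq_nonneg (c.potMean M)]
  have h2 : l * (l * c.devTrSq) ≤ l * c.greenTr M :=
    mul_le_mul_of_nonneg_left ((c.mul_devTrSq_le hl).trans hT) hl0.le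
  have h3 : l ^ 2 * (4 * (1 / (l * δ)) ^ 2) = 4 / δ ^ 2 := by field_simp
  have h4 := mul_le_mul_of_nonneg_left h1 (sq_nonneg l)
  rw [mul_add, h3] at h4
  nlinarith

lemma abs_mixC_sub_greenTr_le (hl : IsSmallestNonzeroEig (1 - c.K) l) (hδ : 0 < δ)
    (hlow : δ ≤ c.piLow M) (hhigh : δ ≤ c.piHigh M)
    {ε : ℝ} (hε : 0 < ε) (hε1 : ε < 1) :
    |mixC (c.sepC 0) ε - c.greenTr M| ≤
      (1 / √ε + 2 / √(1 - ε) + 2 / δ) * √(c.greenTrSq M) := by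
  have hl0 := c.smallestEig_pos hl
  have h := c.pot_bounds hl hδ M hlow hhigh
  have hS := Real.sqrt_le_sqrt (c.devTrSq_le_greenTrSq hl hδ hlow hhigh)
  have hS0 : 0 < √c.devTrSq :=
    pos_of_mul_pos_right (zero_lt_one.trans_le (c.one_le_mul_sqrt_devTrSq hl)) hl0.le
  have hT := c.devTr_eq M
  have h1 : 0 < √ε := Real.sqrt_pos.mpr hε
  have h2 : 0 < √(1 - ε) := Real.sqrt_pos.mpr (sub_pos.mpr hε1)
  have hup := c.mixC_sepC_le (ε := ε) (a := 1 / √ε * √c.devTrSq) (by positivity) (by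
    rw [mul_pow, Real.sq_sqrt c.devTrSq_nonneg, div_pow, Real.sq_sqrt hε.le, one_pow, ← mul_assoc,
      mul_one_div_cancel hε.ne', one_mul])
  have hdown := c.le_mixC_sepC (a := 2 / √(1 - ε) * √c.devTrSq) hε hε1 (by positivity) (by
    rw [mul_pow, Real.sq_sqrt c.devTrSq_nonneg, div_pow, Real.sq_sqrt (sub_pos.mpr hε1).le,
      ← mul_assoc, mul_div_cancel₀ _ (sub_pos.mpr hε1).ne']
    have := Real.sqrt_pos.mp hS0
    linarith)
  have hm : c.potMean M ≤ 2 / δ * √(c.greenTrSq M) := by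
    refine h.2.1.trans ?_
    rw [mul_comm l, ← div_div, div_le_iff₀ hl0, mul_assoc, mul_comm _ l]
    exact le_mul_of_one_le_right (by positivity) (c.one_le_mul_sqrt_greenTrSq hl hδ hlow hhigh)
  have h3 := mul_le_mul_of_nonneg_left hS (one_div_pos.mpr h1).le
  have h4 := mul_le_mul_of_nonneg_left hS (div_pos two_pos h2).le
  have h5 : 0 ≤ 1 / √ε * √c.devTrSq := by positivity
  have h6 : 0 ≤ 2 / √(1 - ε) * √c.devTrSq := by positivity
  rw [abs_le, add_mul, add_mul]
  constructor <;> linarith [h.1]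

lemma mul_mixC_half_le (hl : IsSmallestNonzeroEig (1 - c.K) l) (hδ : 0 < δ)
    (hlow : δ ≤ c.piLow M) (hhigh : δ ≤ c.piHigh M) :
    l * mixC (c.sepC 0) (1 / 2) ≤ 2 * (c.greenTr M * l) + 1 := by
  have hl0 := c.smallestEig_pos hl
  have hS := c.devTrSq_nonneg
  have hS0 : 0 < √c.devTrSq :=
    pos_of_mul_pos_right (zero_lt_one.trans_le (c.one_le_mul_sqrt_devTrSq hl)) hl0.le
  have h1 := c.mixC_sepC_le (ε := 1 / 2) (a := 2 * √c.devTrSq) (by positivity) (by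
    rw [mul_pow, Real.sq_sqrt hS]; linarith)
  have h2 := mul_le_mul_of_nonneg_left h1 hl0.le
  have hT := mul_le_mul_of_nonneg_left (c.devTr_le_greenTr hl hδ hlow hhigh) hl0.le
  have h3 := mul_le_mul_of_nonneg_left (c.mul_devTrSq_le hl) hl0.le
  have h4 := sq_nonneg (l * √c.devTrSq - 1)
  have h5 : (l * √c.devTrSq) ^ 2 = l * (l * c.devTrSq) := by
    rw [mul_pow, Real.sq_sqrt hS]; ring
  nlinarith

end Comparison

end BDChain

section Sequences

variable {T : ℝ → ℕ → ℝ} {s b lam : ℕ → ℝ}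

lemma tendsto_div_of_tendsto_mul {C : ℝ} (hlam : ∀ᶠ n in atTop, 0 < lam n)
    (hb : ∀ᶠ n in atTop, 1 ≤ lam n * b n)
    (hbs : ∀ᶠ n in atTop, (lam n * b n) ^ 2 ≤ s n * lam n + C)
    (h : Tendsto (fun n => s n * lam n) atTop atTop) :
    Tendsto (fun n => s n / b n) atTop atTop := by
  refine tendsto_atTop.mpr fun R => ?_
  filter_upwards [hlam, hb, hbs, h.eventually_ge_atTop C, h.eventually_ge_atTop (2 * R ^ 2),
    h.eventually_ge_atTop 0] with n h1 h2 h3 h4 h5 h6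
  have hb0 : 0 < b n := pos_of_mul_pos_right (zero_lt_one.trans_le h2) h1.le
  rw [le_div_iff₀ hb0]
  refine le_of_mul_le_mul_right ?_ h1
  refine (abs_le_of_sq_le_sq' ?_ h6).2
  calc (R * b n * lam n) ^ 2 = R ^ 2 * (lam n * b n) ^ 2 := by ring
    _ ≤ R ^ 2 * (2 * (s n * lam n)) := by gcongr; linarith
    _ = (2 * R ^ 2) * (s n * lam n) := by ring
    _ ≤ (s n * lam n) * (s n * lam n) := by gcongr
    _ = (s n * lam n) ^ 2 := (sq _).symm

lemma cutoffWindow_of_tendsto_div (hb : ∀ᶠ n in atTop, 0 < b n)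
    (hT : ∀ ε ∈ Set.Ioo (0 : ℝ) 1, ∃ C : ℝ, ∀ᶠ n in atTop, |T ε n - s n| ≤ C * b n)
    (h : Tendsto (fun n => s n / b n) atTop atTop) : cutoffWindow T s b := by
  refine ⟨?_, hb, ?_, hT⟩
  · filter_upwards [hb, h.eventually_gt_atTop 0] with n h1 h2
    have := mul_pos h2 h1
    rwa [div_mul_cancel₀ _ h1.ne'] at this
  · simpa only [Pi.inv_def, inv_div] using h.inv_tendsto_atTop

lemma hasCutoff_of_cutoffWindow (h : cutoffWindow T s b) : hasCutoff T := by
  obtain ⟨hs, -, hlim, hT⟩ := h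
  refine ⟨fun n => if 0 < s n then s n else 1, fun n => ?_, fun ε hε => ?_⟩
  · dsimp only
    split_ifs with h
    · exact h
    · exact one_pos
  · obtain ⟨C, hC⟩ := hT ε hε
    have h0 : Tendsto (fun n => C * (b n / s n)) atTop (nhds 0) := by
      simpa using hlim.const_mul C
    refine tendsto_iff_norm_sub_tendsto_zero.mpr (squeeze_zero' ?_ ?_ h0)
    · exact Eventually.of_forall fun n => norm_nonneg _
    · filter_upwards [hs, hC] with n h1 h2
      rw [if_pos h1, Real.norm_eq_abs, div_sub_one h1.ne', abs_div, abs_of_pos h1, ← mul_div_assoc]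
      exact div_le_div_of_nonneg_right h2 h1.le

lemma tendsto_mul_of_hasCutoff (hlam : ∀ᶠ n in atTop, 0 < lam n)
    (hlog : ∀ ε ∈ Set.Ioo (0 : ℝ) 1, ∀ᶠ n in atTop, -Real.log ε ≤ lam n * T ε n)
    (hhalf : ∀ᶠ n in atTop, lam n * T (1 / 2) n ≤ 2 * (s n * lam n) + 1)
    (h : hasCutoff T) : Tendsto (fun n => s n * lam n) atTop atTop := by
  obtain ⟨t, ht, hcut⟩ := h
  refine tendsto_atTop.mpr fun A => ?_
  set B := max (2 * A + 1) 1 with hB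
  have hB1 : 1 ≤ B := le_max_right _ _
  have hε : Real.exp (-(3 * B)) ∈ Set.Ioo (0 : ℝ) 1 :=
    ⟨Real.exp_pos _, Real.exp_lt_one_iff.mpr (by linarith)⟩
  filter_upwards [hlam, hlog _ hε, hhalf,
    (hcut (1 / 2) (by norm_num)).eventually_const_lt (show (3 / 4 : ℝ) < 1 by norm_num),
    (hcut _ hε).eventually_lt_const (show (1 : ℝ) < 3 / 2 by norm_num)] with n h1 h2 h3 h4 h5
  rw [Real.log_exp, neg_neg] at h2
  rw [lt_div_iff₀ (ht n)] at h4
  rw [div_lt_iff₀ (ht n)] at h5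
  by_contra! hlt
  have h6 : lam n * T (1 / 2) n ≤ B := h3.trans (by linarith [le_max_left (2 * A + 1) 1])
  have h7 : lam n * T (Real.exp (-(3 * B))) n < lam n * (2 * T (1 / 2) n) :=
    mul_lt_mul_of_pos_left (by linarith) h1
  linarith

end Sequences

/-- Theorem `t-sep2`(1).  For a family `F` of irreducible birth and death
chains on `{0,…,n}` (with `F_c` the associated continuous-time chains), `λ_n` the smallest
non-zero eigenvalue of `I − K_n`, states `M_n` with `inf_n π_n([0,M_n]) > 0` and
`inf_n π_n([M_n,n]) > 0`, `s_n = E_0 τ̃_{M_n} + E_n τ̃_{M_n}` and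
`b_n² = Var_0 τ̃_{M_n} + Var_n τ̃_{M_n}`:  the left-boundary family `F_c^L` has a separation
cutoff iff `s_n λ_n → ∞` iff `s_n / b_n → ∞`, and if `s_n / b_n → ∞` then `F_c^L` has a
`(s_n, b_n)` separation cutoff. -/
theorem birth_death_continuous_separation_cutoff
    (F : (n : ℕ) → BDChain n) (lam : ℕ → ℝ)
    (hlam : ∀ n, 0 < n → IsSmallestNonzeroEig (1 - (F n).K) (lam n))
    (M : (n : ℕ) → Fin (n + 1))
    (hMlow : ∃ c > 0, ∀ n, c ≤ (F n).piLow (M n))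
    (hMhigh : ∃ c > 0, ∀ n, c ≤ (F n).piHigh (M n))
    (s b : ℕ → ℝ)
    (hs : ∀ n, s n = (F n).hitMeanC (M n) 0 + (F n).hitMeanC (M n) (Fin.last n))
    (hb : ∀ n, b n =
      Real.sqrt ((F n).hitVarC (M n) 0 + (F n).hitVarC (M n) (Fin.last n))) :
    (hasCutoff (fun ε n => mixC ((F n).sepC 0) ε) ↔
      Filter.Tendsto (fun n => s n * lam n) Filter.atTop Filter.atTop) ∧
    (hasCutoff (fun ε n => mixC ((F n).sepC 0) ε) ↔
      Filter.Tendsto (fun n => s n / b n) Filter.atTop Filter.atTop) ∧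
    (Filter.Tendsto (fun n => s n / b n) Filter.atTop Filter.atTop →
      cutoffWindow (fun ε n => mixC ((F n).sepC 0) ε) s b) := by
  obtain ⟨δ₁, hδ₁, hlow⟩ := hMlow
  obtain ⟨δ₂, hδ₂, hhigh⟩ := hMhigh
  have hδ : 0 < min δ₁ δ₂ := lt_min hδ₁ hδ₂
  replace hlow : ∀ n, min δ₁ δ₂ ≤ (F n).piLow (M n) := fun n => (min_le_left _ _).trans (hlow n)
  replace hhigh : ∀ n, min δ₁ δ₂ ≤ (F n).piHigh (M n) := fun n => (min_le_right _ _).trans (hhigh n)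
  simp only [BDChain.hitMeanC_zero_add_hitMeanC_last] at hs
  simp only [BDChain.hitVarC_zero_add_hitVarC_last] at hb
  obtain rfl : s = fun n => (F n).greenTr (M n) := funext hs
  obtain rfl : b = fun n => √((F n).greenTrSq (M n)) := funext hb
  have hpos : ∀ᶠ n in atTop, 0 < lam n := by
    filter_upwards [eventually_gt_atTop 0] with n hn using (F n).smallestEig_pos (hlam n hn)
  have h1 : ∀ᶠ n in atTop, 1 ≤ lam n * √((F n).greenTrSq (M n)) := by
    filter_upwards [eventually_gt_atTop 0] with n hn using
      (F n).one_le_mul_sqrt_greenTrSq (hlam n hn) hδ (hlow n) (hhigh n)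
  have hb0 : ∀ᶠ n in atTop, 0 < √((F n).greenTrSq (M n)) := by
    filter_upwards [hpos, h1] with n h h' using
      pos_of_mul_pos_right (zero_lt_one.trans_le h') h.le
  have h2 : ∀ᶠ n in atTop, (lam n * √((F n).greenTrSq (M n))) ^ 2 ≤
      (F n).greenTr (M n) * lam n + 4 / (min δ₁ δ₂) ^ 2 := by
    filter_upwards [eventually_gt_atTop 0] with n hn using
      (F n).sq_mul_sqrt_greenTrSq_le (hlam n hn) hδ (hlow n) (hhigh n)
  have hmix : ∀ ε ∈ Set.Ioo (0 : ℝ) 1, ∃ C : ℝ, ∀ᶠ n in atTop,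
      |mixC ((F n).sepC 0) ε - (F n).greenTr (M n)| ≤ C * √((F n).greenTrSq (M n)) := by
    refine fun ε hε => ⟨1 / √ε + 2 / √(1 - ε) + 2 / min δ₁ δ₂, ?_⟩
    filter_upwards [eventually_gt_atTop 0] with n hn using
      (F n).abs_mixC_sub_greenTr_le (hlam n hn) hδ (hlow n) (hhigh n) hε.1 hε.2
  have hlog : ∀ ε ∈ Set.Ioo (0 : ℝ) 1, ∀ᶠ n in atTop,
      -Real.log ε ≤ lam n * mixC ((F n).sepC 0) ε := by
    intro ε hε
    filter_upwards [eventually_gt_atTop 0] with n hn using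
      (F n).neg_log_le_mul_mixC (hlam n hn) hε.1
  have hhalf : ∀ᶠ n in atTop, lam n * mixC ((F n).sepC 0) (1 / 2) ≤
      2 * ((F n).greenTr (M n) * lam n) + 1 := by
    filter_upwards [eventually_gt_atTop 0] with n hn using
      (F n).mul_mixC_half_le (hlam n hn) hδ (hlow n) (hhigh n)
  have hmul := fun h => tendsto_mul_of_hasCutoff
    (T := fun ε n => mixC ((F n).sepC 0) ε) hpos hlog hhalf h
  have hdiv := fun h => tendsto_div_of_tendsto_mul hpos h1 h2 h
  have hwin := fun h => cutoffWindow_of_tendsto_div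
    (T := fun ε n => mixC ((F n).sepC 0) ε) hb0 hmix h
  exact ⟨⟨hmul, fun h => hasCutoff_of_cutoffWindow (hwin (hdiv h))⟩,
    ⟨fun h => hdiv (hmul h), fun h => hasCutoff_of_cutoffWindow (hwin h)⟩, hwin⟩

end
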